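/- arXiv:1612.06990 — 10 statements merged into one kernel-verified Lean document; each statement's English description precedes it below -/
import Mathlib

section
/- Let 𝒱 ⊆ ℂⁿ be a nonempty domain, α ∈ (ℤ₊)ⁿ, and C > 0 a constant. Let F be an α-analytic function on 𝒱 with |F(z)| = C for all z ∈ 𝒱. Then there exist a constant λ ∈ ℂ with |λ| = C and a holomorphic polynomial Q in z_1,…,z_n, of degree at most α_j − 1 in the variable z_j for each j, with Q nonvanishing on 𝒱, such that F(z) = λ·conj(Q(z))/Q(z) for all z ∈ 𝒱. -/
noncomputable section

/-- The Wirtinger derivative `∂/∂z̄_j = ½(∂/∂x_j + i ∂/∂y_j)` of `f : ℂⁿ → ℂ`. -/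
def wirtingerBar (n : ℕ) (j : Fin n) (f : (Fin n → ℂ) → ℂ) : (Fin n → ℂ) → ℂ :=
  fun z => (1 / 2 : ℂ) *
    (fderiv ℝ f z (Pi.single j 1) + Complex.I * fderiv ℝ f z (Pi.single j Complex.I))

/-- `f` is `α`-analytic (polyanalytic of order `α`) on `Ω ⊆ ℂⁿ`: it is smooth and
`(∂/∂z̄_j)^{α_j} f = 0` on `Ω` for each `j`. -/
def PolyanalyticOn (n : ℕ) (α : Fin n → ℕ) (f : (Fin n → ℂ) → ℂ)
    (Ω : Set (Fin n → ℂ)) : Prop :=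
  ContDiffOn ℝ (⊤ : ℕ∞) f Ω ∧ ∀ j : Fin n, ∀ z ∈ Ω, ((wirtingerBar n j)^[α j] f) z = 0

section Wirtinger

variable {n : ℕ} {Ω : Set (Fin n → ℂ)} {f g : (Fin n → ℂ) → ℂ}

theorem wirtingerBar_congr (hΩ : IsOpen Ω) (j : Fin n) (h : Set.EqOn f g Ω) :
    Set.EqOn (wirtingerBar n j f) (wirtingerBar n j g) Ω := by
  intro z hz
  simp only [wirtingerBar, (h.eventuallyEq_of_mem (hΩ.mem_nhds hz)).fderiv_eq]

theorem wirtingerBar_iterate_congr (hΩ : IsOpen Ω) (j : Fin n) (h : Set.EqOn f g Ω) (k : ℕ) :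
    Set.EqOn ((wirtingerBar n j)^[k] f) ((wirtingerBar n j)^[k] g) Ω := by
  induction k generalizing f g with
  | zero => exact h
  | succ k ih => exact ih (wirtingerBar_congr hΩ j h)

theorem contDiffOn_fderiv_apply (hΩ : IsOpen Ω) (hf : ContDiffOn ℝ (⊤ : ℕ∞) f Ω)
    (v : Fin n → ℂ) : ContDiffOn ℝ (⊤ : ℕ∞) (fun z => fderiv ℝ f z v) Ω :=
  (hf.fderiv_of_isOpen hΩ (m := (⊤ : ℕ∞)) (by simp)).clm_apply contDiffOn_const

theorem contDiffOn_wirtingerBar (hΩ : IsOpen Ω) (hf : ContDiffOn ℝ (⊤ : ℕ∞) f Ω) (j : Fin n) :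
    ContDiffOn ℝ (⊤ : ℕ∞) (wirtingerBar n j f) Ω :=
  contDiffOn_const.mul ((contDiffOn_fderiv_apply hΩ hf _).add
    (contDiffOn_const.mul (contDiffOn_fderiv_apply hΩ hf _)))

theorem contDiffOn_wirtingerBar_iterate (hΩ : IsOpen Ω) (hf : ContDiffOn ℝ (⊤ : ℕ∞) f Ω)
    (j : Fin n) (k : ℕ) : ContDiffOn ℝ (⊤ : ℕ∞) ((wirtingerBar n j)^[k] f) Ω := by
  induction k generalizing f with
  | zero => exact hf
  | succ k ih => exact ih (contDiffOn_wirtingerBar hΩ hf j)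

theorem ContDiffOn.differentiableAt_of_isOpen (hf : ContDiffOn ℝ (⊤ : ℕ∞) f Ω) (hΩ : IsOpen Ω)
    {z : Fin n → ℂ} (hz : z ∈ Ω) : DifferentiableAt ℝ f z :=
  (hf.contDiffAt (hΩ.mem_nhds hz)).differentiableAt (by simp)

theorem wirtingerBar_sub {z : Fin n → ℂ} (j : Fin n) (hf : DifferentiableAt ℝ f z)
    (hg : DifferentiableAt ℝ g z) :
    wirtingerBar n j (f - g) z = wirtingerBar n j f z - wirtingerBar n j g z := by
  simp only [wirtingerBar, fderiv_sub hf hg, sub_apply]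
  ring

theorem wirtingerBar_mul {z : Fin n → ℂ} (j : Fin n) (hf : DifferentiableAt ℝ f z)
    (hg : DifferentiableAt ℝ g z) :
    wirtingerBar n j (f * g) z = f z * wirtingerBar n j g z + wirtingerBar n j f z * g z := by
  simp only [wirtingerBar, fderiv_mul hf hg, add_apply,
    smul_apply, smul_eq_mul]
  ring

theorem wirtingerBar_iterate_sub (hΩ : IsOpen Ω) (hf : ContDiffOn ℝ (⊤ : ℕ∞) f Ω)
    (hg : ContDiffOn ℝ (⊤ : ℕ∞) g Ω) (j : Fin n) (k : ℕ) :
    Set.EqOn ((wirtingerBar n j)^[k] (f - g))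
      ((wirtingerBar n j)^[k] f - (wirtingerBar n j)^[k] g) Ω := by
  induction k generalizing f g with
  | zero => exact fun _ _ => rfl
  | succ k ih =>
    refine Set.EqOn.trans (wirtingerBar_iterate_congr hΩ j (fun z hz => ?_) k)
      (ih (contDiffOn_wirtingerBar hΩ hf j) (contDiffOn_wirtingerBar hΩ hg j))
    exact wirtingerBar_sub j (hf.differentiableAt_of_isOpen hΩ hz)
      (hg.differentiableAt_of_isOpen hΩ hz)

theorem wirtingerBar_zero (j : Fin n) : wirtingerBar n j 0 = 0 := by
  ext z
  simp [wirtingerBar]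

theorem wirtingerBar_iterate_zero (j : Fin n) (k : ℕ) : (wirtingerBar n j)^[k] 0 = 0 :=
  Function.iterate_fixed (wirtingerBar_zero j) k

theorem wirtingerBar_comm (hΩ : IsOpen Ω) (hf : ContDiffOn ℝ (⊤ : ℕ∞) f Ω) (i j : Fin n) :
    Set.EqOn (wirtingerBar n i (wirtingerBar n j f)) (wirtingerBar n j (wirtingerBar n i f)) Ω := by
  intro z hz
  have hsymm : IsSymmSndFDerivAt ℝ f z :=
    (hf.contDiffAt (hΩ.mem_nhds hz)).isSymmSndFDerivAt (by
      simpa using WithTop.coe_le_coe.2 (le_top : (2 : ℕ∞) ≤ ⊤))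
  have hd : DifferentiableAt ℝ (fderiv ℝ f) z :=
    ((hf.fderiv_of_isOpen hΩ (m := (⊤ : ℕ∞)) (by simp)).contDiffAt
      (hΩ.mem_nhds hz)).differentiableAt (by simp)
  have key : ∀ (k : Fin n) (v : Fin n → ℂ), fderiv ℝ (wirtingerBar n k f) z v =
      (1 / 2 : ℂ) * (fderiv ℝ (fderiv ℝ f) z v (Pi.single k 1) +
        Complex.I * fderiv ℝ (fderiv ℝ f) z v (Pi.single k Complex.I)) := by
    intro k v
    have h1 : ∀ w : Fin n → ℂ, HasFDerivAt (fun y => fderiv ℝ f y w)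
        ((fderiv ℝ (fderiv ℝ f) z).flip w) z := fun w => by
      simpa using hd.hasFDerivAt.clm_apply (hasFDerivAt_const w z)
    have h2 := ((h1 (Pi.single k 1)).add
      ((h1 (Pi.single k Complex.I)).const_mul Complex.I)).const_mul (1 / 2 : ℂ)
    have h3 : fderiv ℝ (wirtingerBar n k f) z = _ := h2.fderiv
    rw [h3]
    simp [mul_add]
  conv_lhs => rw [wirtingerBar, key, key]
  conv_rhs => rw [wirtingerBar, key, key]
  rw [hsymm (Pi.single i 1) (Pi.single j 1), hsymm (Pi.single i 1) (Pi.single j Complex.I),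
    hsymm (Pi.single i Complex.I) (Pi.single j 1),
    hsymm (Pi.single i Complex.I) (Pi.single j Complex.I)]
  ring

theorem wirtingerBar_comm_iterate (hΩ : IsOpen Ω) (hf : ContDiffOn ℝ (⊤ : ℕ∞) f Ω)
    (i j : Fin n) (k : ℕ) :
    Set.EqOn (wirtingerBar n i ((wirtingerBar n j)^[k] f))
      ((wirtingerBar n j)^[k] (wirtingerBar n i f)) Ω := by
  induction k generalizing f with
  | zero => exact fun _ _ => rfl
  | succ k ih =>
    exact (ih (contDiffOn_wirtingerBar hΩ hf j)).trans
      (wirtingerBar_iterate_congr hΩ j (wirtingerBar_comm hΩ hf i j) k)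

theorem wirtingerBar_iterate_comm_iterate (hΩ : IsOpen Ω) (hf : ContDiffOn ℝ (⊤ : ℕ∞) f Ω)
    (i j : Fin n) (l k : ℕ) :
    Set.EqOn ((wirtingerBar n i)^[l] ((wirtingerBar n j)^[k] f))
      ((wirtingerBar n j)^[k] ((wirtingerBar n i)^[l] f)) Ω := by
  induction l generalizing f with
  | zero => exact fun _ _ => rfl
  | succ l ih =>
    exact (wirtingerBar_iterate_congr hΩ i (wirtingerBar_comm_iterate hΩ hf i j k) l).trans
      (ih (contDiffOn_wirtingerBar hΩ hf i))

/-- The monomial `c * z̄_j ^ m` as a function on `ℂⁿ`. -/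
def conjMonomial (j : Fin n) (c : ℂ) (m : ℕ) : (Fin n → ℂ) → ℂ :=
  fun z => c * starRingEnd ℂ (z j) ^ m

theorem contDiff_conjMonomial (j : Fin n) (c : ℂ) (m : ℕ) :
    ContDiff ℝ (⊤ : ℕ∞) (conjMonomial j c m) := by
  have h : ContDiff ℝ (⊤ : ℕ∞) fun z : Fin n → ℂ => starRingEnd ℂ (z j) :=
    Complex.conjCLE.contDiff.comp (contDiff_apply ℝ ℂ j)
  exact contDiff_const.mul (h.pow m)

theorem wirtingerBar_conjMonomial (i j : Fin n) (c : ℂ) (m : ℕ) :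
    wirtingerBar n i (conjMonomial j c m) =
      if i = j then conjMonomial j (c * m) (m - 1) else 0 := by
  ext z
  have h : HasFDerivAt (fun z : Fin n → ℂ => starRingEnd ℂ (z j))
      ((Complex.conjCLE : ℂ →L[ℝ] ℂ).comp (ContinuousLinearMap.proj j)) z :=
    ((Complex.conjCLE : ℂ →L[ℝ] ℂ).comp
      (ContinuousLinearMap.proj (R := ℝ) (φ := fun _ : Fin n => ℂ) j)).hasFDerivAt
  have h2 : fderiv ℝ (conjMonomial j c m) z = _ := ((h.pow m).const_mul c).fderiv
  rw [wirtingerBar, h2]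
  split_ifs with hij
  · subst hij
    simp [conjMonomial]
    linear_combination (-c * m * starRingEnd ℂ (z i) ^ (m - 1) / 2) * Complex.I_mul_I
  · simp [Ne.symm hij]

theorem wirtingerBar_iterate_conjMonomial_mul_self (hΩ : IsOpen Ω) {h : (Fin n → ℂ) → ℂ}
    (hh : ContDiffOn ℝ (⊤ : ℕ∞) h Ω) (j : Fin n) (hj : ∀ z ∈ Ω, wirtingerBar n j h z = 0)
    (c : ℂ) (m k : ℕ) :
    Set.EqOn ((wirtingerBar n j)^[k] (conjMonomial j c m * h))
      (conjMonomial j (c * m.descFactorial k) (m - k) * h) Ω := by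
  induction k generalizing c m with
  | zero => simp [Set.EqOn]
  | succ k ih =>
    refine Set.EqOn.trans (wirtingerBar_iterate_congr hΩ j
      (g := conjMonomial j (c * m) (m - 1) * h) (fun z hz => ?_) k) ((ih _ _).trans ?_)
    · rw [wirtingerBar_mul j ((contDiff_conjMonomial j c m).contDiffAt.differentiableAt (by simp))
        (hh.differentiableAt_of_isOpen hΩ hz), hj z hz, wirtingerBar_conjMonomial, if_pos rfl]
      simp
    · intro z _
      rcases m with _ | m
      · simp [conjMonomial]
      · simp only [Pi.mul_apply, conjMonomial, Nat.succ_descFactorial_succ]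
        push_cast
        ring

theorem wirtingerBar_iterate_conjMonomial_mul_of_ne (hΩ : IsOpen Ω) {h : (Fin n → ℂ) → ℂ}
    (hh : ContDiffOn ℝ (⊤ : ℕ∞) h Ω) {i j : Fin n} (hij : i ≠ j) (c : ℂ) (m k : ℕ) :
    Set.EqOn ((wirtingerBar n i)^[k] (conjMonomial j c m * h))
      (conjMonomial j c m * (wirtingerBar n i)^[k] h) Ω := by
  induction k generalizing h with
  | zero => exact fun _ _ => rfl
  | succ k ih =>
    refine Set.EqOn.trans (wirtingerBar_iterate_congr hΩ i (fun z hz => ?_) k)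
      (ih (contDiffOn_wirtingerBar hΩ hh i))
    rw [wirtingerBar_mul i ((contDiff_conjMonomial j c m).contDiffAt.differentiableAt (by simp))
      (hh.differentiableAt_of_isOpen hΩ hz), wirtingerBar_conjMonomial, if_neg hij]
    simp

theorem differentiableOn_complex_of_wirtingerBar_eq_zero (hΩ : IsOpen Ω)
    (hf : ContDiffOn ℝ (⊤ : ℕ∞) f Ω) (h : ∀ j, ∀ z ∈ Ω, wirtingerBar n j f z = 0) :
    DifferentiableOn ℂ f Ω := by
  intro z hz
  refine DifferentiableAt.differentiableWithinAt ?_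
  rw [differentiableAt_iff_restrictScalars ℝ (hf.differentiableAt_of_isOpen hΩ hz)]
  set L := fderiv ℝ f z with hL
  have hI : ∀ j, L (Pi.single j Complex.I) = Complex.I * L (Pi.single j 1) := by
    intro j
    have h1 : L (Pi.single j 1) + Complex.I * L (Pi.single j Complex.I) = 0 := by
      simpa [wirtingerBar] using h j z hz
    linear_combination (-Complex.I) * h1 + L (Pi.single j Complex.I) * Complex.I_mul_I
  have hL1 : ∀ v : Fin n → ℂ, L v = ∑ j, v j * L (Pi.single j 1) := by
    intro v
    conv_lhs => rw [← Finset.univ_sum_single v]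
    rw [map_sum]
    refine Finset.sum_congr rfl fun j _ => ?_
    have h1 : (Pi.single j (v j) : Fin n → ℂ) =
        (v j).re • (Pi.single j 1 : Fin n → ℂ) +
          (v j).im • (Pi.single j Complex.I : Fin n → ℂ) := by
      rw [← Pi.single_smul, ← Pi.single_smul, ← Pi.single_add]
      congr 1
      simp [Complex.re_add_im]
    rw [h1, map_add, map_smul, map_smul, hI]
    simp only [Complex.real_smul]
    linear_combination L (Pi.single j 1) * Complex.re_add_im (v j)
  refine ⟨∑ j, L (Pi.single j 1) • ContinuousLinearMap.proj j, ?_⟩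
  ext v
  rw [hL1]
  simp [mul_comm]

end Wirtinger

section ConjPolynomial

open MvPolynomial

variable {n : ℕ} {Ω : Set (Fin n → ℂ)}

/-- Evaluation of a polynomial at the conjugate point `z̄`. -/
def conjEval (z : Fin n → ℂ) : MvPolynomial (Fin n) ℂ →+* ℂ :=
  eval fun j => starRingEnd ℂ (z j)

/-- `F z = P z (z̄)` on `Ω` for a polynomial `P z` with coefficients holomorphic in `z ∈ Ω`
and of degree at most `β j` in the `j`-th variable. -/
structure IsConjPolynomial (Ω : Set (Fin n → ℂ)) (β : Fin n → ℕ) (F : (Fin n → ℂ) → ℂ)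
    (P : (Fin n → ℂ) → MvPolynomial (Fin n) ℂ) : Prop where
  differentiableOn_coeff : ∀ b, DifferentiableOn ℂ (fun z => coeff b (P z)) Ω
  degreeOf_le : ∀ z j, degreeOf j (P z) ≤ β j
  eq_conjEval : ∀ z ∈ Ω, F z = conjEval z (P z)

theorem exists_isConjPolynomial (hΩ : IsOpen Ω) (β : Fin n → ℕ) (F : (Fin n → ℂ) → ℂ)
    (hF : PolyanalyticOn n (fun j => β j + 1) F Ω) : ∃ P, IsConjPolynomial Ω β F P := by
  induction hN : ∑ j, β j using Nat.strong_induction_on generalizing β F with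
  | _ N ih =>
  by_cases h0 : ∀ j, β j = 0
  · refine ⟨fun z => C (F z), fun b => ?_, fun z j => by simp, fun z _ => by simp [conjEval]⟩
    have hd : DifferentiableOn ℂ F Ω := differentiableOn_complex_of_wirtingerBar_eq_zero hΩ hF.1
      fun j z hz => by simpa [h0] using hF.2 j z hz
    by_cases hb : 0 = b
    · simpa [coeff_C, hb] using hd
    · simp [coeff_C, hb]
  push Not at h0
  obtain ⟨j, hj⟩ := h0
  obtain ⟨m, hm⟩ := Nat.exists_eq_succ_of_ne_zero hj
  subst hN
  set h : (Fin n → ℂ) → ℂ := (wirtingerBar n j)^[m + 1] F with hh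
  have hsm : ContDiffOn ℝ (⊤ : ℕ∞) h Ω := contDiffOn_wirtingerBar_iterate hΩ hF.1 j _
  have hhj : ∀ z ∈ Ω, wirtingerBar n j h z = 0 := fun z hz => by
    have := hF.2 j z hz
    beta_reduce at this
    rwa [hm, Nat.succ_eq_add_one, Function.iterate_succ_apply'] at this
  have hhi : ∀ i, ∀ z ∈ Ω, (wirtingerBar n i)^[β i + 1] h z = 0 := fun i z hz => by
    rw [hh, wirtingerBar_iterate_comm_iterate hΩ hF.1 i j _ _ hz,
      wirtingerBar_iterate_congr hΩ j (g := 0) (hF.2 i) _ hz, wirtingerBar_iterate_zero]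
    rfl
  set c : ℂ := ((m + 1).factorial : ℂ)⁻¹ with hc
  have hsm' : ContDiffOn ℝ (⊤ : ℕ∞) (conjMonomial j c (m + 1) * h) Ω :=
    (contDiff_conjMonomial j c (m + 1)).contDiffOn.mul hsm
  have hlt : ∀ k ≤ m, ∑ i, Function.update β j k i < ∑ i, β i := fun k hk =>
    Finset.sum_lt_sum (fun i _ => by
      by_cases hij : i = j
      · subst hij; simp; omega
      · simp [hij]) ⟨j, Finset.mem_univ j, by simp; omega⟩
  obtain ⟨P, hP⟩ := ih _ (hlt m le_rfl) _ (F - conjMonomial j c (m + 1) * h) (by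
    refine ⟨hF.1.sub hsm', fun i z hz => ?_⟩
    beta_reduce
    rw [wirtingerBar_iterate_sub hΩ hF.1 hsm' i _ hz, Pi.sub_apply]
    by_cases hij : i = j
    · subst hij
      rw [Function.update_self,
        wirtingerBar_iterate_conjMonomial_mul_self hΩ hsm i hhj c (m + 1) (m + 1) hz,
        Nat.descFactorial_self, inv_mul_cancel₀ (Nat.cast_ne_zero.2 (Nat.factorial_ne_zero _))]
      simp only [Pi.mul_apply, conjMonomial, hh, Nat.sub_self, pow_zero, mul_one, one_mul, sub_self]
    · rw [Function.update_of_ne hij, hF.2 i z hz,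
        wirtingerBar_iterate_conjMonomial_mul_of_ne hΩ hsm hij c (m + 1) _ hz]
      rw [Pi.mul_apply, hhi i z hz, mul_zero, sub_zero]) rfl
  obtain ⟨R, hR⟩ := ih _ (hlt 0 (Nat.zero_le m)) _ h (by
    refine ⟨hsm, fun i z hz => ?_⟩
    beta_reduce
    by_cases hij : i = j
    · subst hij
      simpa using hhj z hz
    · rw [Function.update_of_ne hij, hhi i z hz]) rfl
  refine ⟨fun z => P z + monomial (Finsupp.single j (m + 1)) c * R z, fun b => ?_, fun z i => ?_,
    fun z hz => ?_⟩
  · simp only [coeff_add, coeff_monomial_mul']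
    refine (hP.differentiableOn_coeff b).add ?_
    split_ifs
    · exact (differentiableOn_const c).mul (hR.differentiableOn_coeff _)
    · exact differentiableOn_const 0
  · refine (degreeOf_add_le _ _ _).trans (max_le ?_ ((degreeOf_mul_le _ _ _).trans ?_))
    · refine (hP.degreeOf_le z i).trans ?_
      by_cases hij : i = j
      · subst hij; simp; omega
      · simp [hij]
    · have h1 := hR.degreeOf_le z i
      have h2 : degreeOf i (monomial (Finsupp.single j (m + 1)) c) ≤
          if i = j then m + 1 else 0 := by
        classical
        rw [degreeOf_eq_sup]
        refine Finset.sup_le fun b hb => ?_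
        rw [Finset.mem_singleton.1 (support_monomial_subset hb), Finsupp.single_apply]
        simp [eq_comm]
      by_cases hij : i = j
      · subst hij
        simp only [Function.update_self, if_true] at h1 h2
        omega
      · simp only [Function.update_of_ne hij, if_neg hij] at h1 h2
        omega
  · have h1 := hP.eq_conjEval z hz
    rw [map_add, map_mul, ← h1, ← hR.eq_conjEval z hz]
    have h2 : conjEval z (monomial (Finsupp.single j (m + 1)) c) =
        conjMonomial j c (m + 1) z := by
      rw [conjEval, eval_monomial, Finsupp.prod_single_index (by simp), conjMonomial]
    rw [h2, Pi.sub_apply, Pi.mul_apply, sub_add_cancel]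

end ConjPolynomial

section Polarization

open MvPolynomial

variable {n : ℕ} {Ω : Set (Fin n → ℂ)} {β : Fin n → ℕ} {F : (Fin n → ℂ) → ℂ}
  {P : (Fin n → ℂ) → MvPolynomial (Fin n) ℂ}

theorem eval_eq_sum_Iic {p : MvPolynomial (Fin n) ℂ} (hp : ∀ j, degreeOf j p ≤ β j)
    (w : Fin n → ℂ) :
    eval w p = ∑ b ∈ Finset.Iic (Finsupp.equivFunOnFinite.symm β), coeff b p * ∏ j, w j ^ b j := by
  rw [eval_eq']
  refine Finset.sum_subset (fun b hb => ?_) fun b _ hb => ?_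
  · exact Finset.mem_Iic.2 fun j => (monomial_le_degreeOf j hb).trans (hp j)
  · rw [notMem_support_iff.1 hb, zero_mul]

theorem conjEval_eq_conj_eval_map (z : Fin n → ℂ) (p : MvPolynomial (Fin n) ℂ) :
    starRingEnd ℂ (conjEval z p) = eval z (map (starRingEnd ℂ) p) := by
  rw [eval_map, conjEval]
  refine (eval₂_comp_left (starRingEnd ℂ) (RingHom.id ℂ) _ p).trans ?_
  congr 1
  ext j
  simp

/-- If `F z = P z (z̄)` has constant modulus `C` near the segment between `z` and `u`, then the
polarized identity `P z (ū) * conj (P u (z̄)) = C ^ 2` holds. -/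
theorem IsConjPolynomial.conjEval_mul_conj_conjEval (hP : IsConjPolynomial Ω β F P)
    {s : Set (Fin n → ℂ)} (hs : IsOpen s) (hconv : Convex ℝ s) (hsΩ : s ⊆ Ω)
    {C : ℝ} (hmod : ∀ z ∈ s, ‖F z‖ = C) {z u : Fin n → ℂ} (hz : z ∈ s) (hu : u ∈ s) :
    conjEval u (P z) * starRingEnd ℂ (conjEval z (P u)) = (C : ℂ) ^ 2 := by
  set p : Fin n → ℂ := (1 / 2 : ℝ) • z + (1 / 2 : ℝ) • u with hp
  set q : Fin n → ℂ := (-Complex.I / 2) • (z - u) with hq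
  set D : Set ℂ := {t | p + t • q ∈ s ∧ p + starRingEnd ℂ t • q ∈ s} with hD
  set k : ℂ → ℂ := fun t =>
    eval (fun j => starRingEnd ℂ (p j) + t * starRingEnd ℂ (q j)) (P (p + t • q)) with hk
  have hps : p ∈ s := hconv hz hu (by norm_num) (by norm_num) (by norm_num)
  have hkd : ∀ t, p + t • q ∈ s → DifferentiableAt ℂ k t := by
    intro t ht
    rw [show k = _ from funext fun t => eval_eq_sum_Iic (hP.degreeOf_le (p + t • q)) _]
    refine DifferentiableAt.fun_sum fun b _ => DifferentiableAt.mul ?_ (by fun_prop)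
    have h1 : DifferentiableAt ℂ (fun z => coeff b (P z)) (p + t • q) :=
      ((hP.differentiableOn_coeff b).mono hsΩ).differentiableAt (hs.mem_nhds ht)
    exact h1.comp t (f := fun t : ℂ => p + t • q) (by fun_prop)
  have hDo : IsOpen D :=
    (hs.preimage (f := fun t : ℂ => p + t • q) (by fun_prop)).inter
      (hs.preimage (f := fun t : ℂ => p + starRingEnd ℂ t • q) (by fun_prop))
  have hDc : Convex ℝ D := by
    intro t₁ h₁ t₂ h₂ a b ha hb hab
    constructor
    · convert hconv h₁.1 h₂.1 ha hb hab using 1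
      ext j
      have : (a : ℂ) + b = 1 := by exact_mod_cast hab
      simp only [Pi.add_apply, Pi.smul_apply, smul_eq_mul, Complex.real_smul]
      linear_combination (-p j) * this
    · convert hconv h₁.2 h₂.2 ha hb hab using 1
      ext j
      have : (a : ℂ) + b = 1 := by exact_mod_cast hab
      simp only [Pi.add_apply, Pi.smul_apply, smul_eq_mul, Complex.real_smul, map_add, map_mul,
        Complex.conj_ofReal]
      linear_combination (-p j) * this
  have h0 : (0 : ℂ) ∈ D := by simp [hD, hps]
  have hpI : p + Complex.I • q = z := by
    ext j
    simp only [hp, hq, Pi.add_apply, Pi.smul_apply, smul_eq_mul, Complex.real_smul, Pi.sub_apply]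
    push_cast
    linear_combination (-(z j - u j) / 2) * Complex.I_mul_I
  have hpI' : p + (-Complex.I) • q = u := by
    ext j
    simp only [hp, hq, Pi.add_apply, Pi.smul_apply, smul_eq_mul, Complex.real_smul, Pi.sub_apply]
    push_cast
    linear_combination ((z j - u j) / 2) * Complex.I_mul_I
  have hI : Complex.I ∈ D := by
    refine ⟨by rwa [hpI], ?_⟩
    rwa [Complex.conj_I, hpI']
  have hreal : ∀ t : ℝ, p + (t : ℂ) • q ∈ s → k t = F (p + (t : ℂ) • q) := by
    intro t ht
    rw [hP.eq_conjEval _ (hsΩ ht), hk, conjEval]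
    simp
  have hfreq : ∃ᶠ t in nhdsWithin (0 : ℂ) {0}ᶜ,
      k t * starRingEnd ℂ (k (starRingEnd ℂ t)) = (C : ℂ) ^ 2 := by
    have ht : Filter.Tendsto (fun t : ℝ => (t : ℂ)) (nhdsWithin 0 {0}ᶜ)
        (nhdsWithin (0 : ℂ) {0}ᶜ) := by
      refine tendsto_nhdsWithin_iff.2 ⟨?_, ?_⟩
      · exact (Complex.continuous_ofReal.tendsto' 0 0 Complex.ofReal_zero).mono_left
          nhdsWithin_le_nhds
      · filter_upwards [self_mem_nhdsWithin] with t ht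
        simpa using ht
    have hev : ∀ᶠ t : ℝ in nhdsWithin 0 {0}ᶜ, (t : ℂ) ∈ D :=
      ht.eventually (nhdsWithin_le_nhds (hDo.mem_nhds h0))
    refine ht.frequently (Filter.Eventually.frequently (hev.mono fun t ht => ?_))
    rw [Complex.conj_ofReal, hreal t ht.1, Complex.mul_conj, Complex.normSq_eq_norm_sq,
      hmod _ ht.1]
    push_cast
    rfl
  have hdiff : DifferentiableOn ℂ (fun t => k t * starRingEnd ℂ (k (starRingEnd ℂ t))) D := by
    intro t ht
    refine DifferentiableAt.differentiableWithinAt ((hkd t ht.1).mul ?_)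
    exact differentiableAt_conj_conj_iff.2 (hkd _ ht.2)
  have key := (hdiff.analyticOnNhd hDo).eqOn_of_preconnected_of_frequently_eq
    analyticOnNhd_const hDc.isPreconnected h0 hfreq hI
  have hkI : k Complex.I = conjEval u (P z) := by
    rw [hk, conjEval]
    beta_reduce
    rw [hpI]
    congr 2
    ext j
    simp [← hpI']
  have hkI' : k (starRingEnd ℂ Complex.I) = conjEval z (P u) := by
    rw [Complex.conj_I, hk, conjEval]
    beta_reduce
    rw [hpI']
    congr 2
    ext j
    simp [← hpI]
  rw [← hkI, ← hkI']
  exact key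

end Polarization

section LocallyConstant

open MvPolynomial

variable {n : ℕ}

theorem MvPolynomial.eq_of_eqOn_isOpen {s : Set (Fin n → ℂ)} (hs : IsOpen s) (hne : s.Nonempty)
    {p q : MvPolynomial (Fin n) ℂ} (h : ∀ z ∈ s, eval z p = eval z q) : p = q := by
  obtain ⟨z, hz⟩ := hne
  obtain ⟨r, hr, hrs⟩ := Metric.isOpen_iff.1 hs z hz
  refine funext_set (fun j => Metric.ball (z j) r) (fun j => ?_) fun w hw => h w (hrs ?_)
  · exact infinite_of_mem_nhds (z j) (Metric.ball_mem_nhds _ hr)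
  · rwa [ball_pi z hr]

theorem MvPolynomial.associated_iff_exists_C {p q : MvPolynomial (Fin n) ℂ} :
    Associated p q ↔ ∃ c : ℂ, c ≠ 0 ∧ q = C c * p := by
  constructor
  · rintro ⟨u, rfl⟩
    obtain ⟨c, hc, hu⟩ := isUnit_iff_eq_C_of_isReduced.1 u.isUnit
    exact ⟨c, hc.ne_zero, by rw [hu, mul_comm]⟩
  · rintro ⟨c, hc, rfl⟩
    exact associated_unit_mul_right p _ ((isUnit_iff_ne_zero.2 hc).map C)

theorem MvPolynomial.associated_iff_coeff_mul_coeff {p q : MvPolynomial (Fin n) ℂ}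
    (hp : p ≠ 0) (hq : q ≠ 0) :
    Associated p q ↔ ∀ a b, coeff a p * coeff b q = coeff b p * coeff a q := by
  rw [associated_iff_exists_C]
  constructor
  · rintro ⟨c, -, rfl⟩ a b
    rw [coeff_C_mul, coeff_C_mul]
    ring
  · intro h
    obtain ⟨a, ha⟩ := exists_coeff_ne_zero hp
    have hqp : q = C (coeff a q / coeff a p) * p := by
      ext b
      rw [coeff_C_mul, div_mul_eq_mul_div, eq_div_iff ha]
      linear_combination h a b
    refine ⟨_, fun h0 => hq ?_, hqp⟩
    rw [hqp, h0, C_0, zero_mul]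

/-- A family of nonzero polynomials with continuous coefficients which all divide a fixed nonzero
polynomial is locally constant up to associates. -/
theorem MvPolynomial.eventually_associated {X : Type*} [TopologicalSpace X] {s : Set X}
    (hs : IsOpen s) {P : X → MvPolynomial (Fin n) ℂ}
    (hP : ∀ b, ContinuousOn (fun x => coeff b (P x)) s) {D : MvPolynomial (Fin n) ℂ} (hD : D ≠ 0)
    (hdvd : ∀ x ∈ s, P x ∣ D) {x : X} (hx : x ∈ s) : ∀ᶠ y in nhds x, Associated (P x) (P y) := by
  have hfin : {c : Associates (MvPolynomial (Fin n) ℂ) | c ∣ Associates.mk D}.Finite := by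
    have := UniqueFactorizationMonoid.fintypeSubtypeDvd (Associates.mk D)
      (Associates.mk_ne_zero.2 hD)
    exact Set.finite_coe_iff.1 (Finite.of_fintype {c // c ∣ Associates.mk D})
  have hne : ∀ y ∈ s, P y ≠ 0 := fun y hy => ne_zero_of_dvd_ne_zero hD (hdvd y hy)
  have key : ∀ c ∈ {c : Associates (MvPolynomial (Fin n) ℂ) | c ∣ Associates.mk D},
      ∀ᶠ y in nhds x, Associates.mk (P y) = c → Associates.mk (P x) = c := by
    intro c hc
    obtain ⟨d, rfl⟩ := Associates.mk_surjective c
    by_cases hdx : Associates.mk (P x) = Associates.mk d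
    · exact Filter.Eventually.of_forall fun _ _ => hdx
    have hd : d ≠ 0 := ne_zero_of_dvd_ne_zero hD (Associates.mk_dvd_mk.1 hc)
    rw [Associates.mk_eq_mk_iff_associated, associated_iff_coeff_mul_coeff (hne x hx) hd] at hdx
    push Not at hdx
    obtain ⟨a, b, hab⟩ := hdx
    have hcont : ∀ a, ContinuousAt (fun x => coeff a (P x)) x := fun a =>
      (hP a).continuousAt (hs.mem_nhds hx)
    have hev := (((hcont a).mul continuousAt_const).ne_iff_eventually_ne
      ((hcont b).mul continuousAt_const)).1 hab
    filter_upwards [hev, hs.mem_nhds hx] with y hy hys h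
    rw [Associates.mk_eq_mk_iff_associated, associated_iff_coeff_mul_coeff (hne y hys) hd] at h
    exact absurd (h a b) hy
  filter_upwards [(Filter.eventually_all_finite hfin).2 key, hs.mem_nhds hx] with y hy hys
  exact Associates.mk_eq_mk_iff_associated.1
    (hy _ (Associates.mk_dvd_mk.2 (hdvd y hys)) rfl)

/-- If `P z (ū) * R u (z)` is a nonzero constant for `z, u` in an open set and the degrees of the
polynomials `P z` are bounded, then the polynomials `R u` have a common multiple. -/
theorem exists_common_multiple_of_conjEval_mul_eval_eq {s : Set (Fin n → ℂ)} (hs : IsOpen s)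
    (hne : s.Nonempty) {β : Fin n → ℕ} {P R : (Fin n → ℂ) → MvPolynomial (Fin n) ℂ}
    (hP : ∀ z j, degreeOf j (P z) ≤ β j) {c : ℂ} (hc : c ≠ 0)
    (h : ∀ z ∈ s, ∀ u ∈ s, conjEval u (P z) * eval z (R u) = c) :
    ∃ D ≠ 0, ∀ u ∈ s, R u ∣ D := by
  have hR : ∀ u ∈ s, R u ≠ 0 := fun u hu h0 => hc (by rw [← h u hu u hu, h0, map_zero, mul_zero])
  let v : (Fin n → ℂ) → (Finset.Iic (Finsupp.equivFunOnFinite.symm β)) → ℂ :=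
    fun u b => ∏ j, starRingEnd ℂ (u j) ^ b.1 j
  have hv : ∀ z u, conjEval u (P z) = ∑ b, coeff b.1 (P z) * v u b := fun z u => by
    rw [conjEval, eval_eq_sum_Iic (hP z), ← Finset.sum_coe_sort]
  obtain ⟨f, hf, hspan, -⟩ := Submodule.exists_fun_fin_finrank_span_eq ℂ (v '' s)
  choose w hws hwf using hf
  refine ⟨C c * ∏ i, R (w i), mul_ne_zero (C_ne_zero.2 hc)
    (Finset.prod_ne_zero_iff.2 fun i _ => hR _ (hws i)), fun u hu => ?_⟩
  have hmem : v u ∈ Submodule.span ℂ (Set.range f) :=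
    hspan.ge (Submodule.subset_span (Set.mem_image_of_mem v hu))
  obtain ⟨a, ha⟩ := (Submodule.mem_span_range_iff_exists_fun ℂ).1 hmem
  have hsum : ∀ z, conjEval u (P z) = ∑ i, a i * conjEval (w i) (P z) := fun z => by
    simp only [hv, ← ha, hwf, Finset.sum_apply, Pi.smul_apply, smul_eq_mul, Finset.mul_sum]
    rw [Finset.sum_comm]
    exact Finset.sum_congr rfl fun _ _ => Finset.sum_congr rfl fun _ _ => by ring
  refine ⟨∑ i, C (a i * c) * ∏ j ∈ Finset.univ.erase i, R (w j),
    eq_of_eqOn_isOpen hs hne fun z hz => ?_⟩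
  simp only [map_mul, map_sum, map_prod, eval_C]
  have hi : ∀ i, a i * c * ∏ j ∈ Finset.univ.erase i, eval z (R (w j)) =
      a i * conjEval (w i) (P z) * ∏ j, eval z (R (w j)) := fun i => by
    rw [← Finset.mul_prod_erase _ _ (Finset.mem_univ i), ← h z hz _ (hws i)]
    ring
  rw [Finset.sum_congr rfl fun i _ => hi i, ← Finset.sum_mul, ← hsum, ← h z hz u hu]
  ring

end LocallyConstant

theorem IsConjPolynomial.eventually_associated {n : ℕ} {Ω : Set (Fin n → ℂ)} {β : Fin n → ℕ}
    {F : (Fin n → ℂ) → ℂ} {P : (Fin n → ℂ) → MvPolynomial (Fin n) ℂ}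
    (hP : IsConjPolynomial Ω β F P) (hΩ : IsOpen Ω) {C : ℝ} (hC : C ≠ 0)
    (hmod : ∀ z ∈ Ω, ‖F z‖ = C) {z : Fin n → ℂ} (hz : z ∈ Ω) :
    ∀ᶠ u in nhds z, Associated (P z) (P u) := by
  obtain ⟨r, hr, hball⟩ := Metric.isOpen_iff.1 hΩ z hz
  have hzr := Metric.mem_ball_self (x := z) hr
  obtain ⟨D, hD, hdvd⟩ := exists_common_multiple_of_conjEval_mul_eval_eq
    (R := fun u => MvPolynomial.map (starRingEnd ℂ) (P u)) Metric.isOpen_ball ⟨z, hzr⟩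
    hP.degreeOf_le (c := (C : ℂ) ^ 2) (pow_ne_zero 2 (Complex.ofReal_ne_zero.2 hC))
    fun w hw u hu => by
      rw [← conjEval_eq_conj_eval_map]
      exact hP.conjEval_mul_conj_conjEval Metric.isOpen_ball (convex_ball z r) hball
        (fun w hw => hmod w (hball hw)) hw hu
  have hinj : Function.Injective (MvPolynomial.map (σ := Fin n) (starRingEnd ℂ)) :=
    MvPolynomial.map_injective _ (starRingEnd ℂ).injective
  refine MvPolynomial.eventually_associated Metric.isOpen_ball
    (fun b => ((hP.differentiableOn_coeff b).continuousOn).mono hball)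
    ((map_ne_zero_iff _ hinj).2 hD) (fun u hu => ?_) hzr
  have h := map_dvd (MvPolynomial.map (starRingEnd ℂ)) (hdvd u hu)
  rwa [MvPolynomial.map_map, RingHomCompTriple.comp_eq (σ₁₃ := RingHom.id ℂ),
    MvPolynomial.map_id] at h

theorem constant_modulus_alpha_analytic
    (n : ℕ) (𝒱 : Set (Fin n → ℂ)) (hopen : IsOpen 𝒱) (hconn : IsConnected 𝒱)
    (α : Fin n → ℕ) (hα : ∀ j, 0 < α j)
    (C : ℝ) (hC : 0 < C)
    (F : (Fin n → ℂ) → ℂ) (hF : PolyanalyticOn n α F 𝒱)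
    (hmod : ∀ z ∈ 𝒱, ‖F z‖ = C) :
    ∃ (lam : ℂ) (Q : MvPolynomial (Fin n) ℂ), ‖lam‖ = C ∧
      (∀ j : Fin n, MvPolynomial.degreeOf j Q ≤ α j - 1) ∧
      (∀ z ∈ 𝒱, MvPolynomial.eval z Q ≠ 0) ∧
      ∀ z ∈ 𝒱, F z =
        lam * starRingEnd ℂ (MvPolynomial.eval z Q) / MvPolynomial.eval z Q := by
  have hβ : (fun j => (α j - 1) + 1) = α := funext fun j => Nat.sub_add_cancel (hα j)
  obtain ⟨P, hP⟩ := exists_isConjPolynomial hopen (fun j => α j - 1) F (hβ.symm ▸ hF)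
  obtain ⟨z₀, hz₀⟩ := hconn.nonempty
  have hF0 : ∀ z ∈ 𝒱, F z ≠ 0 := fun z hz => norm_ne_zero_iff.1 (by rw [hmod z hz]; exact hC.ne')
  have hP0 : ∀ z ∈ 𝒱, P z ≠ 0 := fun z hz h0 => hF0 z hz (by rw [hP.eq_conjEval z hz, h0, map_zero])
  have hassoc : ∀ z ∈ 𝒱, Associated (P z₀) (P z) := fun z hz =>
    hconn.isPreconnected.induction₂ (fun z u => Associated (P z) (P u))
      (fun z hz => nhdsWithin_le_nhds (hP.eventually_associated hopen hC.ne' hmod hz))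
      (fun _ _ _ _ _ _ => Associated.trans) (fun _ _ _ _ => Associated.symm) hz₀ hz
  set Q := MvPolynomial.map (starRingEnd ℂ) (P z₀) with hQ
  have hconjQ : ∀ z, starRingEnd ℂ (MvPolynomial.eval z Q) = conjEval z (P z₀) := fun z => by
    rw [hQ, ← conjEval_eq_conj_eval_map, Complex.conj_conj]
  obtain ⟨b, hb⟩ := MvPolynomial.exists_coeff_ne_zero (hP0 z₀ hz₀)
  set a : (Fin n → ℂ) → ℂ :=
    fun z => MvPolynomial.coeff b (P z) / MvPolynomial.coeff b (P z₀) with ha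
  have haP : ∀ z ∈ 𝒱, P z = MvPolynomial.C (a z) * P z₀ := fun z hz => by
    obtain ⟨c, -, h⟩ := MvPolynomial.associated_iff_exists_C.1 (hassoc z hz)
    have hac : a z = c := by
      simp only [ha, h, MvPolynomial.coeff_C_mul, mul_div_cancel_right₀ _ hb]
    rw [hac, h]
  have hFa : ∀ z ∈ 𝒱, F z = a z * starRingEnd ℂ (MvPolynomial.eval z Q) := fun z hz => by
    rw [hconjQ, hP.eq_conjEval z hz, haP z hz, map_mul]
    simp [conjEval]
  have hQ0 : ∀ z ∈ 𝒱, MvPolynomial.eval z Q ≠ 0 := fun z hz h0 =>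
    hF0 z hz (by rw [hFa z hz, h0, map_zero, mul_zero])
  set g : (Fin n → ℂ) → ℂ := fun z => a z * MvPolynomial.eval z Q with hg
  have hgn : ∀ z ∈ 𝒱, ‖g z‖ = C := fun z hz => by
    rw [← hmod z hz, hFa z hz, norm_mul, norm_mul, RCLike.norm_conj]
  have had : DifferentiableOn ℂ a 𝒱 := by
    simpa only [ha, div_eq_mul_inv] using (hP.differentiableOn_coeff b).mul_const _
  have hgd : DifferentiableOn ℂ g 𝒱 :=
    had.mul fun z _ =>
      (AnalyticOnNhd.eval_mvPolynomial Q z trivial).differentiableAt.differentiableWithinAt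
  have hgc : ∀ z ∈ 𝒱, g z = g z₀ :=
    Complex.eqOn_of_isPreconnected_of_isMaxOn_norm hconn.isPreconnected hopen hgd hz₀
      fun z hz => by simp [hgn z hz, hgn z₀ hz₀]
  refine ⟨g z₀, Q, hgn z₀ hz₀, fun j => ?_, hQ0, fun z hz => ?_⟩
  · exact (MvPolynomial.degreeOf_le_iff.2 fun m hm => MvPolynomial.degreeOf_le_iff.1
      (hP.degreeOf_le z₀ j) m (MvPolynomial.support_map_subset _ _ hm))
  · rw [← hgc z hz, hFa z hz, eq_div_iff (hQ0 z hz), hg]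
    ring
end
end

section
/- Let U ⊆ ℂⁿ be an open set and let G : cl U → ℂ be continuous. Suppose that for every nonempty bounded open set W with W ⊆ U ∖ G⁻¹(0) and cl W ⊆ U, one has sup_{z∈cl W}|G(z)| = sup_{z∈∂W}|G(z)|. Then for every nonempty bounded open set V with cl V ⊆ U, one has sup_{z∈cl V}|G(z)| = sup_{z∈∂V}|G(z)|. -/
noncomputable section

theorem bmmp_across_zero_set
    (n : ℕ) (U : Set (Fin n → ℂ)) (hU : IsOpen U)
    (G : (Fin n → ℂ) → ℂ) (hG : ContinuousOn G (closure U))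
    (h : ∀ W : Set (Fin n → ℂ), W.Nonempty → IsOpen W → Bornology.IsBounded W →
      W ⊆ U → (∀ z ∈ W, G z ≠ 0) → closure W ⊆ U →
      sSup ((fun z => ‖G z‖) '' closure W) = sSup ((fun z => ‖G z‖) '' frontier W)) :
    ∀ V : Set (Fin n → ℂ), V.Nonempty → IsOpen V → Bornology.IsBounded V →
      closure V ⊆ U →
      sSup ((fun z => ‖G z‖) '' closure V) = sSup ((fun z => ‖G z‖) '' frontier V) := by
  intro V _ hVo hVb hVU
  have hbdd : ∀ S ⊆ closure V, BddAbove ((fun z => ‖G z‖) '' S) := fun S hS =>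
    (hVb.isCompact_closure.bddAbove_image
      (hG.mono (hVU.trans subset_closure)).norm).mono (Set.image_mono hS)
  have hfr : frontier V ⊆ closure V := frontier_subset_closure
  have hnonneg : 0 ≤ sSup ((fun z => ‖G z‖) '' frontier V) :=
    Real.sSup_nonneg (by rintro _ ⟨z, _, rfl⟩; exact norm_nonneg _)
  have hle : ∀ z ∈ frontier V, ‖G z‖ ≤ sSup ((fun z => ‖G z‖) '' frontier V) := fun z hz =>
    le_csSup (hbdd _ hfr) (Set.mem_image_of_mem _ hz)
  apply le_antisymm
  · refine Real.sSup_le ?_ hnonneg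
    rintro _ ⟨z, hz, rfl⟩
    by_cases hzV : z ∈ V
    · by_cases hGz : G z = 0
      · simpa [hGz] using hnonneg
      let W := V ∩ G ⁻¹' {0}ᶜ
      have hWo : IsOpen W :=
        (hG.mono ((subset_closure.trans hVU).trans subset_closure)).isOpen_inter_preimage
          hVo isOpen_compl_singleton
      have hWV : closure W ⊆ closure V := closure_mono Set.inter_subset_left
      have hzW : z ∈ W := ⟨hzV, hGz⟩
      have hWsup := h W ⟨z, hzW⟩ hWo (hVb.subset Set.inter_subset_left)
        (Set.inter_subset_left.trans (subset_closure.trans hVU)) (fun w hw => hw.2)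
        (hWV.trans hVU)
      calc ‖G z‖ ≤ sSup ((fun z => ‖G z‖) '' closure W) :=
            le_csSup (hbdd _ hWV) (Set.mem_image_of_mem _ (subset_closure hzW))
        _ = sSup ((fun z => ‖G z‖) '' frontier W) := hWsup
        _ ≤ sSup ((fun z => ‖G z‖) '' frontier V) := by
          refine Real.sSup_le ?_ hnonneg
          rintro _ ⟨w, hw, rfl⟩
          rw [hWo.frontier_eq] at hw
          by_cases hwV : w ∈ V
          · have hGw : G w = 0 := by
              by_contra hGw
              exact hw.2 ⟨hwV, hGw⟩
            simpa [hGw] using hnonneg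
          · exact hle w (hVo.frontier_eq ▸ ⟨hWV hw.1, hwV⟩)
    · exact hle z (hVo.frontier_eq ▸ ⟨hz, hzV⟩)
  · refine Real.sSup_le ?_ (Real.sSup_nonneg (by rintro _ ⟨z, _, rfl⟩; exact norm_nonneg _))
    rintro _ ⟨z, hz, rfl⟩
    exact le_csSup (hbdd _ subset_rfl) (Set.mem_image_of_mem _ (hfr hz))
end
end

section
/- Let Ω ⊂ ℂ be a bounded domain, let U ⊆ Ω be a nonempty open set, let f : cl Ω → ℂ be continuous with f(z) = 0 for every z ∈ ∂U ∩ Ω and f(z) ≠ 0 for every z ∈ U, and let g : cl U → ℂ be continuous on cl U and holomorphic on U. Assume that for every positive integer j and every z ∈ U, |f(z)·g(z)^j| ≤ sup_{w∈∂U}|f(w)·g(w)^j|. Then for every z ∈ U, |g(z)| ≤ sup_{w∈∂U∩∂Ω}|g(w)|. -/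
noncomputable section

theorem holomorphic_bound_from_weighted_maximum_principle
    (Ω : Set ℂ) (hopen : IsOpen Ω) (hconn : IsConnected Ω)
    (hbdd : Bornology.IsBounded Ω)
    (U : Set ℂ) (hUopen : IsOpen U) (hUne : U.Nonempty) (hUΩ : U ⊆ Ω)
    (f : ℂ → ℂ) (hf : ContinuousOn f (closure Ω))
    (hfzero : ∀ z ∈ frontier U ∩ Ω, f z = 0)
    (hfne : ∀ z ∈ U, f z ≠ 0)
    (g : ℂ → ℂ) (hg : ContinuousOn g (closure U)) (hghol : DifferentiableOn ℂ g U)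
    (hmax : ∀ j : ℕ, 0 < j → ∀ z ∈ U,
      ‖f z * g z ^ j‖ ≤ sSup ((fun w => ‖f w * g w ^ j‖) '' frontier U)) :
    ∀ z ∈ U, ‖g z‖ ≤ sSup ((fun w => ‖g w‖) '' (frontier U ∩ frontier Ω)) := by
  intro z hz
  have hUcl : closure U ⊆ closure Ω := closure_mono hUΩ
  have hΩc : IsCompact (closure Ω) := hbdd.isCompact_closure
  have hEc : IsCompact (frontier U ∩ frontier Ω) :=
    hΩc.of_isClosed_subset (isClosed_frontier.inter isClosed_frontier)
      fun w hw => hUcl (frontier_subset_closure hw.1)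
  obtain ⟨C, hC⟩ := hΩc.exists_bound_of_continuousOn hf
  have hbound : BddAbove ((fun w => ‖g w‖) '' (frontier U ∩ frontier Ω)) :=
    hEc.bddAbove_image (hg.mono fun w hw => frontier_subset_closure hw.1).norm
  set M := sSup ((fun w => ‖g w‖) '' (frontier U ∩ frontier Ω))
  have hM0 : 0 ≤ M := Real.sSup_nonneg (by rintro _ ⟨w, -, rfl⟩; exact norm_nonneg _)
  have hC0 : 0 ≤ C := (norm_nonneg _).trans (hC z (subset_closure (hUΩ hz)))
  have key : ∀ j : ℕ, 0 < j → ‖f z‖ * ‖g z‖ ^ j ≤ C * M ^ j := by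
    intro j hj
    rw [← norm_pow, ← norm_mul]
    refine (hmax j hj z hz).trans (Real.sSup_le ?_ (by positivity))
    rintro _ ⟨w, hw, rfl⟩
    have hwΩ : w ∈ closure Ω := hUcl (frontier_subset_closure hw)
    by_cases h : w ∈ Ω
    · simp only [hfzero w ⟨hw, h⟩, zero_mul, norm_zero]
      positivity
    · have hwE : w ∈ frontier U ∩ frontier Ω := ⟨hw, by
        rw [hopen.frontier_eq]; exact ⟨hwΩ, h⟩⟩
      have hgM : ‖g w‖ ≤ M := le_csSup hbound ⟨w, hwE, rfl⟩
      simp only [norm_mul, norm_pow]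
      gcongr
      exact hC w hwΩ
  by_contra! hlt
  have hg0 : 0 < ‖g z‖ := hM0.trans_lt hlt
  have hlim : Filter.Tendsto (fun j : ℕ => C * (M / ‖g z‖) ^ j) Filter.atTop (nhds 0) := by
    simpa using (tendsto_pow_atTop_nhds_zero_of_lt_one (by positivity)
      ((div_lt_one hg0).2 hlt)).const_mul C
  have hle : ‖f z‖ ≤ 0 := by
    refine ge_of_tendsto hlim ?_
    filter_upwards [Filter.eventually_gt_atTop 0] with j hj
    rw [div_pow, ← mul_div_assoc, le_div_iff₀ (by positivity)]
    exact key j hj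
  exact hfne z hz (norm_le_zero_iff.1 hle)
end
end

section
/- Let U ⊆ ℂ be a domain, let q be a positive integer, and let (f_k)_{k∈ℕ} be a sequence of q-analytic functions on U that converges uniformly on U to a function f. Then f is q-analytic on U. -/
noncomputable section

/-- A function `f` is `q`-analytic (polyanalytic of order `q`) on `U ⊆ ℂ` if
`f(z) = ∑_{j<q} a_j(z) * (conj z)^j` for holomorphic functions `a_j` on `U`. -/
def QAnalyticOn (q : ℕ) (f : ℂ → ℂ) (U : Set ℂ) : Prop :=
  ∃ a : Fin q → ℂ → ℂ, (∀ j, DifferentiableOn ℂ (a j) U) ∧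
    ∀ z ∈ U, f z = ∑ j : Fin q, a j z * (starRingEnd ℂ z) ^ (j : ℕ)

open Metric Filter Topology

/-- The coefficients of a polynomial of degree `< q` are controlled linearly by its values at `q`
distinct points. -/
theorem exists_norm_coeff_le_sum_norm_eval {q : ℕ} {s : Fin q → ℂ} (hs : Function.Injective s) :
    ∃ W : Fin q → Fin q → ℝ, (∀ j i, 0 ≤ W j i) ∧ ∀ (x : Fin q → ℂ) (j : Fin q),
      ‖x j‖ ≤ ∑ i, W j i * ‖∑ k, x k * s i ^ (k : ℕ)‖ := by
  set V := Matrix.vandermonde s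
  have hV : IsUnit V.det := (Matrix.det_vandermonde_ne_zero_iff.2 hs).isUnit
  refine ⟨fun j i => ‖V⁻¹ j i‖, fun _ _ => norm_nonneg _, fun x j => ?_⟩
  have hx : x j = ∑ i, V⁻¹ j i * ∑ k, x k * s i ^ (k : ℕ) := by
    have h : V⁻¹.mulVec (V.mulVec x) = x := by
      rw [Matrix.mulVec_mulVec, Matrix.nonsing_inv_mul V hV, Matrix.one_mulVec]
    conv_lhs => rw [← h]
    simp [Matrix.mulVec, dotProduct, V, Matrix.vandermonde_apply, mul_comm]
  calc ‖x j‖ = ‖∑ i, V⁻¹ j i * ∑ k, x k * s i ^ (k : ℕ)‖ := by rw [← hx]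
    _ ≤ _ := (norm_sum_le _ _).trans_eq (by simp)

/-- Maximum modulus principle on a closed disc. -/
theorem norm_le_of_forall_sphere_norm_le {g : ℂ → ℂ} {c : ℂ} {r M : ℝ} (hr : 0 < r)
    (hg : DifferentiableOn ℂ g (closedBall c r)) (hM : ∀ z ∈ sphere c r, ‖g z‖ ≤ M) :
    ∀ z ∈ closedBall c r, ‖g z‖ ≤ M := by
  intro z hz
  rw [← closure_ball c hr.ne'] at hg hz
  refine Complex.norm_le_of_forall_mem_frontier_norm_le isBounded_ball hg.diffContOnCl ?_ hz
  rwa [frontier_ball c hr.ne']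

/-- On a disc, the holomorphic coefficients with respect to powers of `conj (z - c)` are bounded
by the supremum of the polyanalytic function on a larger concentric disc. -/
theorem exists_norm_centered_coeff_le (q : ℕ) (c : ℂ) {r : ℝ} (hr : 0 < r) :
    ∃ C : Fin q → ℝ, ∀ (b : Fin q → ℂ → ℂ) (M : ℝ),
      (∀ j, DifferentiableOn ℂ (b j) (closedBall c (q * r))) →
      (∀ z ∈ closedBall c (q * r), ‖∑ j, b j z * starRingEnd ℂ (z - c) ^ (j : ℕ)‖ ≤ M) →
      ∀ j, ∀ z ∈ closedBall c r, ‖b j z‖ ≤ C j * M := by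
  set ρ : Fin q → ℝ := fun i => ((i : ℕ) + 1) * r
  have hρr : ∀ i, r ≤ ρ i := fun i => le_mul_of_one_le_left hr.le (by simp)
  have hρ : ∀ i, 0 < ρ i := fun i => hr.trans_le (hρr i)
  have hρq : ∀ i, ρ i ≤ q * r := fun i =>
    mul_le_mul_of_nonneg_right (mod_cast i.isLt) hr.le
  have hinj : Function.Injective fun i => ((ρ i : ℂ)) ^ 2 := by
    intro i k h
    beta_reduce at h
    have h1 : ρ i ^ 2 = ρ k ^ 2 := by exact_mod_cast h
    have h2 : ρ i = ρ k := (sq_eq_sq₀ (hρ i).le (hρ k).le).1 h1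
    have h3 := mul_right_cancel₀ hr.ne' h2
    exact Fin.ext (by exact_mod_cast add_right_cancel h3)
  obtain ⟨W, hW, hcoeff⟩ := exists_norm_coeff_le_sum_norm_eval hinj
  refine ⟨fun j => (∑ i, W j i * ρ i ^ (q - 1)) / r ^ (q - 1 - (j : ℕ)), fun b M hb hM => ?_⟩
  have key : ∀ i, ∀ z ∈ closedBall c r,
      ‖∑ j : Fin q, b j z * (z - c) ^ (q - 1 - (j : ℕ)) * ((ρ i : ℂ) ^ 2) ^ (j : ℕ)‖
        ≤ ρ i ^ (q - 1) * M := by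
    intro i z hz
    refine norm_le_of_forall_sphere_norm_le
      (g := fun z => ∑ j : Fin q, b j z * (z - c) ^ (q - 1 - (j : ℕ)) * ((ρ i : ℂ) ^ 2) ^ (j : ℕ))
      (hρ i) ?_ ?_ z
      (closedBall_subset_closedBall (hρr i) hz)
    · refine DifferentiableOn.fun_sum fun j _ => ?_
      have := (hb j).mono (closedBall_subset_closedBall (hρq i))
      fun_prop
    · intro z hz
      have hzc : ‖z - c‖ = ρ i := by rwa [mem_sphere_iff_norm] at hz
      have hsum : ∑ j : Fin q, b j z * (z - c) ^ (q - 1 - (j : ℕ)) * ((ρ i : ℂ) ^ 2) ^ (j : ℕ)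
          = (z - c) ^ (q - 1) * ∑ j, b j z * starRingEnd ℂ (z - c) ^ (j : ℕ) := by
        rw [Finset.mul_sum]
        refine Finset.sum_congr rfl fun j _ => ?_
        have hj : q - 1 = (q - 1 - (j : ℕ)) + j := by have := j.isLt; omega
        rw [← hzc, ← Complex.mul_conj', mul_pow]
        conv_rhs => rw [hj, pow_add]
        ring
      rw [hsum, norm_mul, norm_pow, hzc]
      exact mul_le_mul_of_nonneg_left
        (hM z (closedBall_subset_closedBall (hρq i) (sphere_subset_closedBall hz)))
        (pow_nonneg (hρ i).le _)
  intro j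
  refine norm_le_of_forall_sphere_norm_le hr
    ((hb j).mono (closedBall_subset_closedBall ((hρr j).trans (hρq j)))) fun z hz => ?_
  have hzc : ‖z - c‖ = r := by rwa [mem_sphere_iff_norm] at hz
  have h := hcoeff (fun j => b j z * (z - c) ^ (q - 1 - (j : ℕ))) j
  rw [div_mul_eq_mul_div, le_div_iff₀ (pow_pos hr _)]
  rw [norm_mul, norm_pow, hzc] at h
  refine h.trans ?_
  rw [Finset.sum_mul]
  refine Finset.sum_le_sum fun i _ => ?_
  rw [mul_assoc]
  exact mul_le_mul_of_nonneg_left (key i z (sphere_subset_closedBall hz)) (hW j i)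

/-- Taylor shift of a polynomial of degree `< q`. -/
theorem sum_mul_add_pow_eq {q : ℕ} (a : Fin q → ℂ) (d v : ℂ) :
    ∑ j, a j * (v + d) ^ (j : ℕ) =
      ∑ m : Fin q, (∑ j : Fin q, a j * (d ^ ((j : ℕ) - m) * ((j : ℕ).choose m))) *
        v ^ (m : ℕ) := by
  simp_rw [Finset.sum_mul]
  rw [Finset.sum_comm]
  refine Finset.sum_congr rfl fun j _ => ?_
  have h : (v + d) ^ (j : ℕ) =
      ∑ m ∈ Finset.range q, v ^ m * d ^ ((j : ℕ) - m) * ((j : ℕ).choose m) := by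
    rw [add_pow]
    refine Finset.sum_subset (Finset.range_subset_range.2 j.isLt) fun m _ hm => ?_
    rw [Nat.choose_eq_zero_of_lt (by simpa using hm)]
    simp
  rw [h, Finset.sum_range, Finset.mul_sum]
  exact Finset.sum_congr rfl fun m _ => by ring

/-- On a disc, the holomorphic coefficients with respect to powers of `conj z` are bounded by the
supremum of the polyanalytic function on a larger concentric disc. -/
theorem exists_norm_coeff_le (q : ℕ) (c : ℂ) {r : ℝ} (hr : 0 < r) :
    ∃ C : Fin q → ℝ, ∀ (a : Fin q → ℂ → ℂ) (M : ℝ),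
      (∀ j, DifferentiableOn ℂ (a j) (closedBall c (q * r))) →
      (∀ z ∈ closedBall c (q * r), ‖∑ j, a j z * starRingEnd ℂ z ^ (j : ℕ)‖ ≤ M) →
      ∀ j, ∀ z ∈ closedBall c r, ‖a j z‖ ≤ C j * M := by
  set d := starRingEnd ℂ c
  have hinj : Function.Injective fun i : Fin q => ((i : ℕ) : ℂ) + d := fun i k h =>
    Fin.ext (by exact_mod_cast add_right_cancel h)
  obtain ⟨W, hW, hcoeff⟩ := exists_norm_coeff_le_sum_norm_eval hinj
  obtain ⟨C, hC⟩ := exists_norm_centered_coeff_le q c hr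
  refine ⟨fun j => ∑ i, W j i * ∑ m, C m * ((i : ℕ) : ℝ) ^ (m : ℕ), fun a M ha hM j z hz => ?_⟩
  set b : Fin q → ℂ → ℂ := fun m z =>
    ∑ j : Fin q, a j z * (d ^ ((j : ℕ) - m) * ((j : ℕ).choose m))
  have hb : ∀ m, DifferentiableOn ℂ (b m) (closedBall c (q * r)) := fun m =>
    DifferentiableOn.fun_sum fun j _ => (ha j).mul_const _
  have hshift : ∀ z v, ∑ j, a j z * (v + d) ^ (j : ℕ) = ∑ m, b m z * v ^ (m : ℕ) :=
    fun z v => sum_mul_add_pow_eq (fun j => a j z) d v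
  have hbound := hC b M hb fun z hz => by
    rw [← hshift, ← map_add, sub_add_cancel]
    exact hM z hz
  refine (hcoeff (fun j => a j z) j).trans ?_
  rw [Finset.sum_mul]
  refine Finset.sum_le_sum fun i _ => ?_
  rw [mul_assoc]
  refine mul_le_mul_of_nonneg_left ?_ (hW j i)
  rw [hshift, Finset.sum_mul]
  refine (norm_sum_le _ _).trans (Finset.sum_le_sum fun m _ => ?_)
  rw [norm_mul, norm_pow, Complex.norm_natCast, mul_right_comm]
  exact mul_le_mul_of_nonneg_right (hbound m z hz) (by positivity)

/-- The coefficients of a uniformly convergent sequence of polyanalytic functions are locally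
uniformly Cauchy. -/
theorem exists_uniformCauchySeqOn_coeff {U : Set ℂ} (hopen : IsOpen U) {q : ℕ} (hq : 0 < q)
    {f : ℕ → ℂ → ℂ} {F : ℂ → ℂ} {a : ℕ → Fin q → ℂ → ℂ}
    (ha : ∀ k j, DifferentiableOn ℂ (a k j) U)
    (hf : ∀ k, ∀ z ∈ U, f k z = ∑ j, a k j z * starRingEnd ℂ z ^ (j : ℕ))
    (hconv : TendstoUniformlyOn f F atTop U) (j : Fin q) {c : ℂ} (hc : c ∈ U) :
    ∃ t ∈ 𝓝 c, UniformCauchySeqOn (fun k => a k j) atTop t := by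
  obtain ⟨R, hR, hRU⟩ := nhds_basis_closedBall.mem_iff.1 (hopen.mem_nhds hc)
  have hq' : (0 : ℝ) < q := mod_cast hq
  have hr : 0 < R / q := div_pos hR hq'
  have hqr : q * (R / q) = R := mul_div_cancel₀ R hq'.ne'
  obtain ⟨C, hC⟩ := exists_norm_coeff_le q c hr
  rw [hqr] at hC
  refine ⟨closedBall c (R / q), closedBall_mem_nhds c hr, Metric.uniformCauchySeqOn_iff.2 ?_⟩
  intro ε hε
  obtain ⟨N, hN⟩ := Metric.uniformCauchySeqOn_iff.1 hconv.uniformCauchySeqOn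
    (ε / (|C j| + 1)) (by positivity)
  refine ⟨N, fun m hm n hn z hz => ?_⟩
  have h := hC (fun j z => a m j z - a n j z) (ε / (|C j| + 1))
    (fun j => ((ha m j).sub (ha n j)).mono hRU) (fun z hz => ?_) j z hz
  · rw [dist_eq_norm]
    refine h.trans_lt ?_
    rw [mul_div_assoc', div_lt_iff₀ (by positivity)]
    nlinarith [le_abs_self (C j)]
  · have := hN m hm n hn z (hRU hz)
    rw [dist_eq_norm, hf m z (hRU hz), hf n z (hRU hz), ← Finset.sum_sub_distrib] at this
    simpa only [sub_mul] using this.le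

theorem uniform_limit_q_analytic
    (U : Set ℂ) (hopen : IsOpen U) (hconn : IsConnected U)
    (q : ℕ) (hq : 0 < q)
    (f : ℕ → ℂ → ℂ) (F : ℂ → ℂ)
    (hfa : ∀ k : ℕ, QAnalyticOn q (f k) U)
    (hconv : TendstoUniformlyOn f F Filter.atTop U) :
    QAnalyticOn q F U := by
  choose a ha hf using hfa
  have hcauchy := fun j c (hc : c ∈ U) => exists_uniformCauchySeqOn_coeff hopen hq ha hf hconv j hc
  have hlim : ∀ (j : Fin q) (z : ℂ), ∃ l, z ∈ U → Tendsto (fun k => a k j z) atTop (𝓝 l) := by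
    intro j z
    by_cases hz : z ∈ U
    · obtain ⟨t, ht, hta⟩ := hcauchy j z hz
      obtain ⟨l, hl⟩ := cauchySeq_tendsto_of_complete (hta.cauchySeq (mem_of_mem_nhds ht))
      exact ⟨l, fun _ => hl⟩
    · exact ⟨0, fun h => absurd h hz⟩
  choose A hA using hlim
  refine ⟨A, fun j => ?_, fun z hz => ?_⟩
  · have hloc : TendstoLocallyUniformlyOn (fun k => a k j) (A j) atTop U := by
      refine tendstoLocallyUniformlyOn_of_forall_exists_nhds fun c hc => ?_
      obtain ⟨t, ht, hta⟩ := hcauchy j c hc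
      exact ⟨t ∩ U, inter_mem (mem_nhdsWithin_of_mem_nhds ht) self_mem_nhdsWithin,
        (hta.mono Set.inter_subset_left).tendstoUniformlyOn_of_tendsto fun z hz => hA j z hz.2⟩
    exact hloc.differentiableOn (Eventually.of_forall fun k => ha k j) hopen
  · refine tendsto_nhds_unique (hconv.tendsto_at hz) ?_
    simp_rw [fun k => hf k z hz]
    exact tendsto_finsetSum _ fun j _ => (hA j z hz).mul_const _
end
end

section
/- Let Ω ⊆ ℂ be a domain and let f be a q-analytic function on Ω. Then |f| is constant on Ω if and only if there exist a constant λ ∈ ℂ and a polynomial P of degree at most q−1, with no zeros in Ω, such that f(z) = λ·conj(P(z))/P(z) for all z ∈ Ω. -/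
noncomputable section

section

open Polynomial Metric Set Filter Topology ComplexConjugate

theorem eqOn_zero_of_forall_real_eq_zero {g : ℂ → ℂ} {r : ℝ} (hr : 0 < r)
    (hg : DifferentiableOn ℂ g (ball 0 r)) (h : ∀ t : ℝ, |t| < r → g t = 0) :
    EqOn g 0 (ball 0 r) := by
  refine (hg.analyticOnNhd isOpen_ball).eqOn_zero_of_preconnected_of_frequently_eq_zero
    isPreconnected_ball (mem_ball_self hr) ?_
  have ht : Tendsto ((↑) : ℝ → ℂ) (𝓝[≠] 0) (𝓝[≠] 0) := by
    refine tendsto_nhdsWithin_iff.2 ⟨?_, ?_⟩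
    · exact (Complex.continuous_ofReal.tendsto' 0 0 Complex.ofReal_zero).mono_left nhdsWithin_le_nhds
    · filter_upwards [self_mem_nhdsWithin] with t ht
      simpa using ht
  refine ht.frequently (Eventually.frequently ?_)
  filter_upwards [nhdsWithin_le_nhds (ball_mem_nhds (0 : ℝ) hr)] with t ht
  exact h t (by simpa using ht)

/-- A holomorphic function of two variables vanishing on the antidiagonal `w = conj z` vanishes
identically near it. -/
theorem eq_zero_of_eq_zero_on_conj {Φ : ℂ × ℂ → ℂ} {z₀ : ℂ} {r : ℝ}
    (hΦ : DifferentiableOn ℂ Φ (ball z₀ (2 * r) ×ˢ ball (conj z₀) (2 * r)))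
    (h : ∀ z ∈ ball z₀ (2 * r), Φ (z, conj z) = 0) {z w : ℂ}
    (hz : z ∈ ball z₀ r) (hw : w ∈ ball (conj z₀) r) : Φ (z, w) = 0 := by
  have hr : 0 < r := pos_of_mem_ball hz
  set Ψ : ℂ → ℂ → ℂ := fun x y =>
    Φ (z₀ + x + Complex.I * y, conj z₀ + x - Complex.I * y) with hΨ
  have hmem : ∀ x ∈ ball (0 : ℂ) r, ∀ y ∈ ball (0 : ℂ) r,
      (z₀ + x + Complex.I * y, conj z₀ + x - Complex.I * y) ∈
        ball z₀ (2 * r) ×ˢ ball (conj z₀) (2 * r) := by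
    intro x hx y hy
    rw [mem_ball_zero_iff] at hx hy
    refine ⟨?_, ?_⟩
    · rw [mem_ball_iff_norm, show z₀ + x + Complex.I * y - z₀ = x + Complex.I * y by ring]
      refine (norm_add_le _ _).trans_lt ?_
      rw [norm_mul, Complex.norm_I]
      linarith
    · rw [mem_ball_iff_norm,
        show conj z₀ + x - Complex.I * y - conj z₀ = x - Complex.I * y by ring]
      refine (norm_sub_le _ _).trans_lt ?_
      rw [norm_mul, Complex.norm_I]
      linarith
  have hreal : ∀ s t : ℝ, |s| < r → |t| < r → Ψ s t = 0 := by
    intro s t hs ht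
    have hm := (hmem s (by simpa using hs) t (by simpa using ht)).1
    have := h _ hm
    simpa [hΨ, sub_eq_add_neg] using this
  have hleft : ∀ s : ℝ, |s| < r → EqOn (Ψ s) 0 (ball 0 r) := by
    intro s hs
    refine eqOn_zero_of_forall_real_eq_zero hr ?_ fun t ht => hreal s t hs ht
    exact hΦ.comp (by fun_prop) fun y hy => hmem s (by simpa using hs) y hy
  have hall : ∀ y ∈ ball (0 : ℂ) r, EqOn (fun x => Ψ x y) 0 (ball 0 r) := by
    intro y hy
    refine eqOn_zero_of_forall_real_eq_zero hr ?_ fun s hs => hleft s hs hy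
    exact hΦ.comp (by fun_prop) fun x hx => hmem x hx y hy
  rw [mem_ball_iff_norm] at hz hw
  have hx : (z - z₀ + (w - conj z₀)) / 2 ∈ ball (0 : ℂ) r := by
    rw [mem_ball_zero_iff, norm_div, Complex.norm_ofNat, div_lt_iff₀ two_pos]
    exact (norm_add_le _ _).trans_lt (by linarith)
  have hy : (z - z₀ - (w - conj z₀)) / (2 * Complex.I) ∈ ball (0 : ℂ) r := by
    rw [mem_ball_zero_iff, norm_div, norm_mul, Complex.norm_ofNat, Complex.norm_I, mul_one,
      div_lt_iff₀ two_pos]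
    exact (norm_sub_le _ _).trans_lt (by linarith)
  have key := hall _ hy hx
  simp only [hΨ, Pi.zero_apply] at key
  convert key using 3 <;> field_simp <;> ring

theorem exists_infinite_fiber_roots {g : ℂ → ℂ[X]} {H : ℂ[X]} (hH : H ≠ 0) {S : Set ℂ}
    (hS : S.Infinite) (hdvd : ∀ w ∈ S, g w ∣ H) :
    ∃ m : Multiset ℂ, {w ∈ S | (g w).roots = m}.Infinite := by
  have hfin : (Iic H.roots).Finite :=
    (H.roots.powerset.toFinset.finite_toSet).subset fun m hm => by simpa using hm
  by_contra! hcon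
  refine hS ((hfin.biUnion fun m _ => hcon m).subset fun w hw => ?_)
  exact mem_biUnion (show (g w).roots ∈ Iic H.roots from roots.le_of_dvd hH (hdvd w hw)) ⟨hw, rfl⟩

theorem dvd_prod_of_eval_mul_eval_eq {p g : ℂ → ℂ[X]} {k : ℂ} (hk : k ≠ 0) {A B : Set ℂ}
    (hA : A.Infinite) (hpg : ∀ z ∈ A, ∀ w ∈ B, (p z).eval w * (g w).eval z = k)
    {s : Finset ℂ} (hs : ↑s ⊆ B) (hdeg : ∀ z ∈ A, (p z).degree < s.card) {w : ℂ} (hw : w ∈ B) :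
    g w ∣ ∏ i ∈ s, g i := by
  refine ⟨∑ i ∈ s, C ((Lagrange.basis s id i).eval w) * ∏ j ∈ s.erase i, g j,
    eq_of_infinite_eval_eq _ _ (hA.mono fun z hz => ?_)⟩
  have hp : (p z).eval w = ∑ i ∈ s, (p z).eval i * (Lagrange.basis s id i).eval w := by
    conv_lhs => rw [Lagrange.eq_interpolate (s := s) (v := id) Function.injective_id.injOn (hdeg z hz)]
    simp [Lagrange.interpolate_apply, eval_finsetSum]
  have hterm : ∀ i ∈ s, k * ∏ j ∈ s.erase i, (g j).eval z
      = (p z).eval i * ∏ j ∈ s, (g j).eval z := by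
    intro i hi
    rw [← Finset.mul_prod_erase s _ hi, ← mul_assoc, hpg z hz i (hs hi)]
  refine mul_left_cancel₀ hk ?_
  simp only [eval_mul, eval_prod, eval_finsetSum, eval_C]
  calc k * ∏ j ∈ s, (g j).eval z
      = (g w).eval z * ((p z).eval w * ∏ j ∈ s, (g j).eval z) := by
        rw [← hpg z hz w hw]; ring
    _ = (g w).eval z * ∑ i ∈ s, (Lagrange.basis s id i).eval w *
          (k * ∏ j ∈ s.erase i, (g j).eval z) := by
        rw [hp, Finset.sum_mul]
        congr 1
        refine Finset.sum_congr rfl fun i hi => ?_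
        rw [hterm i hi]; ring
    _ = _ := by
        simp only [Finset.mul_sum]
        exact Finset.sum_congr rfl fun i _ => by ring

/-- Two families of polynomials of degree less than `q` with `p z (w) * g w (z)` constant
separate variables: `p z` is a fixed polynomial divided by a polynomial in `z`. -/
theorem exists_separation {p g : ℂ → ℂ[X]} {k : ℂ} (hk : k ≠ 0) {A B : Set ℂ} {q : ℕ}
    (hA : A.Infinite) (hB : B.Infinite)
    (hpg : ∀ z ∈ A, ∀ w ∈ B, (p z).eval w * (g w).eval z = k)
    (hp : ∀ z ∈ A, (p z).degree < q) (hg : ∀ w ∈ B, (g w).degree < q) :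
    ∃ D R : ℂ[X], D ≠ 0 ∧ D.degree < q ∧ R.degree < q ∧
      ∀ z ∈ A, C (D.eval z) * p z = R := by
  obtain ⟨z₁, hz₁⟩ := hA.nonempty
  have hg0 : ∀ w ∈ B, g w ≠ 0 := by
    intro w hw h0
    have := hpg z₁ hz₁ w hw
    simp [h0, hk.symm] at this
  obtain ⟨s, hsB, rfl⟩ := hB.exists_subset_card_eq q
  obtain ⟨m, hm⟩ := exists_infinite_fiber_roots (g := g)
    (Finset.prod_ne_zero_iff.2 fun i hi => hg0 i (hsB hi)) hB
    fun w hw => dvd_prod_of_eval_mul_eval_eq hk hA hpg hsB hp hw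
  set D : ℂ[X] := (m.map fun a => X - C a).prod with hD
  have hfac : ∀ w ∈ {w ∈ B | (g w).roots = m}, g w = C (g w).leadingCoeff * D := by
    rintro w ⟨-, rfl⟩
    exact (IsAlgClosed.splits (g w)).eq_prod_roots
  refine ⟨D, C (D.eval z₁) * p z₁, ?_, ?_, ?_, fun z hz => ?_⟩
  · exact (monic_multisetProd_X_sub_C m).ne_zero
  · obtain ⟨w, hw⟩ := hm.nonempty
    have h := hg w hw.1
    rwa [hfac w hw, degree_C_mul (leadingCoeff_ne_zero.2 (hg0 w hw.1))] at h
  · rw [C_mul']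
    exact (degree_smul_le _ _).trans_lt (hp z₁ hz₁)
  · refine eq_of_infinite_eval_eq _ _ (hm.mono fun w hw => ?_)
    refine mul_left_cancel₀ (leadingCoeff_ne_zero.2 (hg0 w hw.1)) ?_
    have h : ∀ z ∈ A, (g w).leadingCoeff * (D.eval z * (p z).eval w) = k := by
      intro z hz
      have := hpg z hz w hw.1
      rw [hfac w hw, eval_mul, eval_C] at this
      linear_combination this
    simp only [eval_mul, eval_C]
    rw [h z hz, h z₁ hz₁]

theorem norm_eq_of_eq_mul_conj_div {P lam f : ℂ} (hP : P ≠ 0) (h : f = lam * conj P / P) :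
    ‖f‖ = ‖lam‖ := by
  rw [h, norm_div, norm_mul, RCLike.norm_conj, mul_div_cancel_right₀ _ (norm_ne_zero_iff.2 hP)]

/-- Polarization of `‖f z‖ ^ 2 = k` for `f z = ∑ j, a j z * conj z ^ j`. -/
theorem polarize_norm_sq {q : ℕ} {a : Fin q → ℂ → ℂ} {z₀ k : ℂ} {r : ℝ}
    (ha : ∀ j, DifferentiableOn ℂ (a j) (ball z₀ (2 * r)))
    (h : ∀ z ∈ ball z₀ (2 * r),
      (∑ j, a j z * conj z ^ (j : ℕ)) * conj (∑ j, a j z * conj z ^ (j : ℕ)) = k)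
    {z w : ℂ} (hz : z ∈ ball z₀ r) (hw : w ∈ ball (conj z₀) r) :
    (∑ j, a j z * w ^ (j : ℕ)) * ∑ j, conj (a j (conj w)) * z ^ (j : ℕ) = k := by
  have ha' : ∀ j, DifferentiableOn ℂ (fun w => conj (a j (conj w))) (ball (conj z₀) (2 * r)) := by
    intro j w hw
    have hw' : conj w ∈ ball z₀ (2 * r) := by
      rw [mem_ball_iff_norm] at hw ⊢
      rwa [← RCLike.norm_conj, map_sub, Complex.conj_conj]
    have := ((ha j).differentiableAt (isOpen_ball.mem_nhds hw')).conj_conj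
    rw [Complex.conj_conj] at this
    exact this.differentiableWithinAt
  have hfst : ∀ j, DifferentiableOn ℂ (fun x : ℂ × ℂ => a j x.1)
      (ball z₀ (2 * r) ×ˢ ball (conj z₀) (2 * r)) :=
    fun j => (ha j).comp differentiableOn_fst fun x hx => hx.1
  have hsnd : ∀ j, DifferentiableOn ℂ (fun x : ℂ × ℂ => conj (a j (conj x.2)))
      (ball z₀ (2 * r) ×ˢ ball (conj z₀) (2 * r)) :=
    fun j => (ha' j).comp differentiableOn_snd fun x hx => hx.2
  refine sub_eq_zero.1 (eq_zero_of_eq_zero_on_conj (Φ := fun x : ℂ × ℂ =>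
    (∑ j, a j x.1 * x.2 ^ (j : ℕ)) * (∑ j, conj (a j (conj x.2)) * x.1 ^ (j : ℕ)) - k)
    ?_ (fun z hz => ?_) hz hw)
  · exact ((DifferentiableOn.fun_sum fun j _ => (hfst j).mul (by fun_prop)).mul
      (DifferentiableOn.fun_sum fun j _ => (hsnd j).mul (by fun_prop))).sub_const k
  · simpa [sub_eq_zero] using h z hz

theorem exists_coeff_mul_eval_eq_const {q : ℕ} {a : Fin q → ℂ → ℂ} {Ω : Set ℂ} {k : ℂ}
    (hopen : IsOpen Ω) (hconn : IsConnected Ω) (ha : ∀ j, DifferentiableOn ℂ (a j) Ω)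
    (hk : k ≠ 0) (h : ∀ z ∈ Ω,
      (∑ j, a j z * conj z ^ (j : ℕ)) * conj (∑ j, a j z * conj z ^ (j : ℕ)) = k) :
    ∃ D R : ℂ[X], D ≠ 0 ∧ D.degree < q ∧ R.degree < q ∧
      ∀ j : Fin q, ∀ z ∈ Ω, D.eval z * a j z = R.coeff j := by
  obtain ⟨z₀, hz₀⟩ := hconn.nonempty
  obtain ⟨ρ, hρ, hball⟩ := Metric.isOpen_iff.1 hopen z₀ hz₀
  obtain ⟨r, rfl⟩ : ∃ r, ρ = 2 * r := ⟨ρ / 2, by ring⟩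
  have hr : 0 < r := by linarith
  have hsum_degree : ∀ c : Fin q → ℂ, (∑ j, C (c j) * X ^ (j : ℕ)).degree < (q : WithBot ℕ) := fun c =>
    degree_sum_fin_lt c
  obtain ⟨D, R, hD, hDq, hRq, hDR⟩ := exists_separation (q := q)
    (p := fun z => ∑ j, C (a j z) * X ^ (j : ℕ))
    (g := fun w => ∑ j, C (conj (a j (conj w))) * X ^ (j : ℕ)) hk
    (infinite_of_mem_nhds z₀ (ball_mem_nhds z₀ hr))
    (infinite_of_mem_nhds (conj z₀) (ball_mem_nhds (conj z₀) hr))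
    (fun z hz w hw => by
      simpa [eval_finsetSum] using
        polarize_norm_sq (fun j => (ha j).mono hball) (fun z hz => h z (hball hz)) hz hw)
    (fun z _ => hsum_degree _) (fun w _ => hsum_degree _)
  refine ⟨D, R, hD, hDq, hRq, fun j => ?_⟩
  have hana : AnalyticOnNhd ℂ (fun z => D.eval z * a j z) Ω :=
    (D.differentiable.differentiableOn.mul (ha j)).analyticOnNhd hopen
  refine hana.eqOn_of_preconnected_of_eventuallyEq analyticOnNhd_const hconn.isPreconnected hz₀ ?_
  filter_upwards [ball_mem_nhds z₀ hr] with z hz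
  rw [← hDR z hz, coeff_C_mul]
  simp [finsetSum_coeff, coeff_X_pow, Fin.val_inj]

theorem exists_eq_mul_conj_eval_div {q : ℕ} {f : ℂ → ℂ} {Ω : Set ℂ} {c : ℝ}
    (hopen : IsOpen Ω) (hconn : IsConnected Ω) (hf : QAnalyticOn q f Ω) (hc : 0 < c)
    (hnorm : ∀ z ∈ Ω, ‖f z‖ = c) :
    ∃ (lam : ℂ) (P : ℂ[X]), P.natDegree < q ∧ (∀ z ∈ Ω, P.eval z ≠ 0) ∧
      ∀ z ∈ Ω, f z = lam * conj (P.eval z) / P.eval z := by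
  obtain ⟨a, ha, hfa⟩ := hf
  obtain ⟨D, R, hD, hDq, hRq, hDR⟩ := exists_coeff_mul_eval_eq_const (k := (c : ℂ) ^ 2) hopen hconn
    ha (pow_ne_zero 2 (Complex.ofReal_ne_zero.2 hc.ne')) fun z hz => by
      rw [← hfa z hz, Complex.mul_conj', hnorm z hz]
  have hfD : ∀ z ∈ Ω, f z * D.eval z = R.eval (conj z) := by
    intro z hz
    rw [hfa z hz, Finset.sum_mul, eval_eq_sum (p := R), ← sum_fin _ (by simp) hRq]
    refine Finset.sum_congr rfl fun j _ => ?_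
    rw [← hDR j z hz]
    ring
  have hR : R ≠ 0 := by
    rintro rfl
    refine hD (eq_zero_of_infinite_isRoot D ?_)
    obtain ⟨z₀, hz₀⟩ := hconn.nonempty
    refine (infinite_of_mem_nhds z₀ (hopen.mem_nhds hz₀)).mono fun z hz => ?_
    have hfz : f z ≠ 0 := norm_ne_zero_iff.1 (by rw [hnorm z hz]; exact hc.ne')
    simpa [hfz] using hfD z hz
  have hD0 : ∀ z ∈ Ω, D.eval z ≠ 0 := by
    intro z hz h0
    refine hR (Polynomial.ext fun n => ?_)
    rcases lt_or_ge n q with hn | hn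
    · simpa [h0] using (hDR ⟨n, hn⟩ z hz).symm
    · simpa using coeff_eq_zero_of_degree_lt (hRq.trans_le (by exact_mod_cast hn))
  set S : ℂ[X] := R.map (starRingEnd ℂ) with hS
  have hSR : ∀ z, R.eval (conj z) = conj (S.eval z) := by
    intro z
    rw [hS, eval_map, hom_eval₂,
      show (starRingEnd ℂ).comp (starRingEnd ℂ) = RingHom.id ℂ from RingHom.ext Complex.conj_conj]
    rfl
  have hquot : ∀ z ∈ Ω, ‖S.eval z / D.eval z‖ = c := by
    intro z hz
    rw [norm_div, ← RCLike.norm_conj (S.eval z), ← hSR, ← hfD z hz, norm_mul, hnorm z hz,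
      mul_div_cancel_right₀ _ (norm_ne_zero_iff.2 (hD0 z hz))]
  obtain ⟨z₀, hz₀⟩ := hconn.nonempty
  have hconst : ∀ z ∈ Ω, S.eval z / D.eval z = S.eval z₀ / D.eval z₀ :=
    Complex.eqOn_of_isPreconnected_of_isMaxOn_norm hconn.isPreconnected hopen
      (S.differentiable.differentiableOn.div D.differentiable.differentiableOn hD0) hz₀
      fun z hz => ((hquot z hz).trans (hquot z₀ hz₀).symm).le
  refine ⟨conj (S.eval z₀ / D.eval z₀), D, (natDegree_lt_iff_degree_lt hD).2 hDq, hD0, fun z hz => ?_⟩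
  rw [eq_div_iff (hD0 z hz), hfD z hz, hSR, ← map_mul, ← hconst z hz,
    div_mul_cancel₀ _ (hD0 z hz)]

end

theorem constant_modulus_q_analytic_iff
    (Ω : Set ℂ) (hopen : IsOpen Ω) (hconn : IsConnected Ω)
    (q : ℕ) (hq : 0 < q)
    (f : ℂ → ℂ) (hf : QAnalyticOn q f Ω) :
    (∀ z ∈ Ω, ∀ w ∈ Ω, ‖f z‖ = ‖f w‖) ↔
      ∃ (lam : ℂ) (P : Polynomial ℂ), P.natDegree ≤ q - 1 ∧
        (∀ z ∈ Ω, P.eval z ≠ 0) ∧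
        ∀ z ∈ Ω, f z = lam * starRingEnd ℂ (P.eval z) / P.eval z := by
  constructor
  · intro h
    obtain ⟨z₀, hz₀⟩ := hconn.nonempty
    rcases (norm_nonneg (f z₀)).eq_or_lt' with h0 | hpos
    · refine ⟨0, 1, by simp, by simp, fun z hz => ?_⟩
      simpa using norm_eq_zero.1 ((h z hz z₀ hz₀).trans h0)
    · obtain ⟨lam, P, hP, hP0, hfP⟩ :=
        exists_eq_mul_conj_eval_div hopen hconn hf hpos fun z hz => h z hz z₀ hz₀
      exact ⟨lam, P, Nat.le_sub_one_of_lt hP, hP0, hfP⟩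
  · rintro ⟨lam, P, -, hP0, hfP⟩ z hz w hw
    rw [norm_eq_of_eq_mul_conj_div (hP0 z hz) (hfP z hz),
      norm_eq_of_eq_mul_conj_div (hP0 w hw) (hfP w hw)]
end
end

section
/- Let q be a positive integer and let f be a q-analytic function on all of ℂ such that |f| is constant on ℂ. Then f is constant. -/
noncomputable section

/-- An entire function of one complex variable that vanishes on the real line is zero. -/
theorem eq_zero_of_differentiable_of_ofReal_eq_zero {g : ℂ → ℂ} (hg : Differentiable ℂ g)
    (h : ∀ x : ℝ, g x = 0) (z : ℂ) : g z = 0 := by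
  have hA : AnalyticOnNhd ℂ g Set.univ := fun z _ => hg.analyticAt z
  refine hA.eqOn_zero_of_preconnected_of_frequently_eq_zero isPreconnected_univ
    (Set.mem_univ (0 : ℂ)) ?_ (Set.mem_univ z)
  have hT : Filter.Tendsto (fun x : ℝ => (x : ℂ)) (nhdsWithin 0 {0}ᶜ) (nhdsWithin 0 {0}ᶜ) := by
    refine tendsto_nhdsWithin_iff.2 ⟨?_, ?_⟩
    · exact (Complex.continuous_ofReal.tendsto' 0 0 (by simp)).mono_left nhdsWithin_le_nhds
    · filter_upwards [self_mem_nhdsWithin] with x hx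
      simpa using hx
  exact hT.frequently (Filter.Eventually.of_forall h).frequently

/-- Polarization: an entire function of two complex variables that vanishes on the
antidiagonal `w = conj z` is zero. -/
theorem eq_zero_of_differentiable_of_conj_eq_zero {H : ℂ × ℂ → ℂ} (hH : Differentiable ℂ H)
    (h : ∀ z : ℂ, H (z, starRingEnd ℂ z) = 0) (z w : ℂ) : H (z, w) = 0 := by
  have hreal (y : ℝ) (x : ℂ) : H (x + Complex.I * y, x - Complex.I * y) = 0 := by
    refine eq_zero_of_differentiable_of_ofReal_eq_zero
      (g := fun x : ℂ => H (x + Complex.I * y, x - Complex.I * y)) (by fun_prop) (fun x => ?_) x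
    simpa [sub_eq_add_neg] using h (x + Complex.I * y)
  have hcomplex (x y : ℂ) : H (x + Complex.I * y, x - Complex.I * y) = 0 :=
    eq_zero_of_differentiable_of_ofReal_eq_zero
      (g := fun y : ℂ => H (x + Complex.I * y, x - Complex.I * y)) (by fun_prop)
      (fun y => hreal y x) y
  have hzw := hcomplex ((z + w) / 2) (-Complex.I * ((z - w) / 2))
  have hI : Complex.I * (-Complex.I * ((z - w) / 2)) = (z - w) / 2 := by
    rw [← mul_assoc, mul_neg, Complex.I_mul_I]
    ring
  rw [hI] at hzw
  convert hzw using 3 <;> ring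

/-- A complex polynomial function without zeros is constant. -/
theorem sum_mul_pow_eq_of_ne_zero {q : ℕ} (c : Fin q → ℂ)
    (h : ∀ w : ℂ, ∑ j : Fin q, c j * w ^ (j : ℕ) ≠ 0) (w w' : ℂ) :
    ∑ j : Fin q, c j * w ^ (j : ℕ) = ∑ j : Fin q, c j * w' ^ (j : ℕ) := by
  set p : Polynomial ℂ := ∑ j : Fin q, Polynomial.C (c j) * Polynomial.X ^ (j : ℕ) with hp
  have heval (w : ℂ) : p.eval w = ∑ j : Fin q, c j * w ^ (j : ℕ) := by
    simp [hp, Polynomial.eval_finsetSum]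
  have hdeg : p.degree ≤ 0 := by
    by_contra! hpos
    obtain ⟨w, hw⟩ := Complex.exists_root hpos
    exact h w (by rw [← heval]; exact hw)
  rw [← heval, ← heval, Polynomial.eq_C_of_degree_le_zero hdeg]
  simp

theorem entire_q_analytic_constant_modulus_is_constant
    (q : ℕ) (hq : 0 < q) (f : ℂ → ℂ)
    (hf : QAnalyticOn q f Set.univ)
    (hmod : ∀ z w : ℂ, ‖f z‖ = ‖f w‖) :
    ∃ c : ℂ, ∀ z : ℂ, f z = c := by
  obtain ⟨a, ha, hfa⟩ := hf
  replace ha (j : Fin q) : Differentiable ℂ (a j) := differentiableOn_univ.1 (ha j)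
  by_cases h0 : f 0 = 0
  · exact ⟨0, fun z => norm_eq_zero.1 (by rw [hmod z 0, h0, norm_zero])⟩
  have hb (j : Fin q) :
      Differentiable ℂ (fun w => starRingEnd ℂ (a j (starRingEnd ℂ w))) := by
    intro w
    exact differentiableAt_conj_conj_iff.2 (ha j (starRingEnd ℂ w))
  have hprod (z w : ℂ) : (∑ j : Fin q, a j z * w ^ (j : ℕ)) *
      (∑ j : Fin q, starRingEnd ℂ (a j (starRingEnd ℂ w)) * z ^ (j : ℕ)) -
        (‖f 0‖ : ℂ) ^ 2 = 0 := by
    refine eq_zero_of_differentiable_of_conj_eq_zero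
      (H := fun p : ℂ × ℂ => (∑ j : Fin q, a j p.1 * p.2 ^ (j : ℕ)) *
        (∑ j : Fin q, starRingEnd ℂ (a j (starRingEnd ℂ p.2)) * p.1 ^ (j : ℕ)) -
          (‖f 0‖ : ℂ) ^ 2) ?_ (fun z => ?_) z w
    · have ha' (j : Fin q) : Differentiable ℂ (fun p : ℂ × ℂ => a j p.1) :=
        (ha j).comp differentiable_fst
      have hb' (j : Fin q) : Differentiable ℂ
          (fun p : ℂ × ℂ => starRingEnd ℂ (a j (starRingEnd ℂ p.2))) :=
        (hb j).comp differentiable_snd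
      fun_prop
    · have hconj : ∑ j : Fin q, starRingEnd ℂ (a j z) * z ^ (j : ℕ) = starRingEnd ℂ (f z) := by
        simp [hfa z (Set.mem_univ z)]
      simp only [Complex.conj_conj]
      rw [hconj, ← hfa z (Set.mem_univ z), Complex.mul_conj', hmod z 0, sub_self]
  have hne (z w : ℂ) : ∑ j : Fin q, a j z * w ^ (j : ℕ) ≠ 0 := by
    intro hzero
    have := hprod z w
    simp [hzero, h0] at this
  have hf0 : f = fun z => ∑ j : Fin q, a j z * (0 : ℂ) ^ (j : ℕ) := by
    funext z
    rw [hfa z (Set.mem_univ z)]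
    exact sum_mul_pow_eq_of_ne_zero (fun j => a j z) (hne z) _ _
  have hfd : Differentiable ℂ f := by
    rw [hf0]
    fun_prop
  refine ⟨f 0, fun z => hfd.apply_eq_apply_of_bounded ?_ z 0⟩
  refine isBounded_iff_forall_norm_le.2 ⟨‖f 0‖, ?_⟩
  rintro _ ⟨w, rfl⟩
  exact (hmod w 0).le
end
end

section
/- Let U ⊆ ℂ be a domain, let f and g be q-analytic functions on U, and let E ⊆ U be a set that has a condensation point of order q. If f(z) = g(z) for all z ∈ E, then f ≡ g on U. -/
noncomputable section

/-- The line `{p + t·e^{iθ} : t ∈ ℝ}` is a limiting direction of `E` at `p`: `E` contains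
points `p + t_j e^{iθ_j}` with `t_j ≠ 0`, `t_j → 0` and `θ_j → θ`. -/
def LimitingDirection (E : Set ℂ) (p : ℂ) (θ : ℝ) : Prop :=
  ∃ (t : ℕ → ℝ) (θs : ℕ → ℝ), (∀ j, t j ≠ 0) ∧
    Filter.Tendsto t Filter.atTop (nhds 0) ∧
    Filter.Tendsto θs Filter.atTop (nhds θ) ∧
    ∀ j, p + (t j : ℂ) * Complex.exp (Complex.I * (θs j : ℂ)) ∈ E

/-- `p` is a condensation point of order `k` of `E`: there are `k` distinct lines through
`p` (i.e. directions `θ` pairwise not congruent modulo `π`) which are limiting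
directions of `E` at `p`. -/
def CondensationPoint (E : Set ℂ) (p : ℂ) (k : ℕ) : Prop :=
  ∃ θ : Fin k → ℝ,
    (∀ a b : Fin k, a ≠ b → ∀ m : ℤ, θ a - θ b ≠ m * Real.pi) ∧
    ∀ a : Fin k, LimitingDirection E p (θ a)

open Filter Topology

/-- A polynomial in `conj z` with holomorphic coefficients can be re-centred at any point. -/
lemma QAnalyticOn.exists_recentred {q : ℕ} {f : ℂ → ℂ} {U : Set ℂ} (hf : QAnalyticOn q f U)
    (p : ℂ) :
    ∃ b : Fin q → ℂ → ℂ, (∀ j, DifferentiableOn ℂ (b j) U) ∧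
      ∀ z ∈ U, f z = ∑ j : Fin q, b j z * (starRingEnd ℂ (z - p)) ^ (j : ℕ) := by
  obtain ⟨a, ha, hfa⟩ := hf
  refine ⟨fun k z => ∑ j : Fin q,
    a j z * ((starRingEnd ℂ p) ^ ((j : ℕ) - (k : ℕ)) * ((j : ℕ).choose k : ℂ)), ?_, ?_⟩
  · intro k
    exact DifferentiableOn.fun_sum fun j _ => (ha j).mul_const _
  · intro z hz
    rw [hfa z hz]
    simp_rw [Finset.sum_mul]
    rw [Finset.sum_comm]
    refine Finset.sum_congr rfl fun j _ => ?_
    have hpow : (starRingEnd ℂ z) ^ (j : ℕ) = ∑ k ∈ Finset.range q,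
        (starRingEnd ℂ (z - p)) ^ k * (starRingEnd ℂ p) ^ ((j : ℕ) - k)
          * ((j : ℕ).choose k : ℂ) := by
      have hz' : starRingEnd ℂ z = starRingEnd ℂ (z - p) + starRingEnd ℂ p := by simp
      rw [hz', add_pow]
      refine Finset.sum_subset (Finset.range_subset_range.2 j.2) fun k _ hk => ?_
      rw [Nat.choose_eq_zero_of_lt (by simpa using hk)]
      simp
    rw [hpow, Finset.sum_range, Finset.mul_sum]
    refine Finset.sum_congr rfl fun k _ => ?_
    ring

lemma QAnalyticOn.sub {q : ℕ} {f g : ℂ → ℂ} {U : Set ℂ} (hf : QAnalyticOn q f U)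
    (hg : QAnalyticOn q g U) : QAnalyticOn q (fun z => f z - g z) U := by
  obtain ⟨a, ha, hfa⟩ := hf
  obtain ⟨b, hb, hgb⟩ := hg
  refine ⟨fun j z => a j z - b j z, fun j => (ha j).sub (hb j), fun z hz => ?_⟩
  simp only [hfa z hz, hgb z hz, sub_mul, Finset.sum_sub_distrib]

lemma exp_neg_two_mul_ne {θ φ : ℝ} (h : ∀ m : ℤ, θ - φ ≠ m * Real.pi) :
    Complex.exp (-2 * Complex.I * θ) ≠ Complex.exp (-2 * Complex.I * φ) := by
  intro heq
  obtain ⟨n, hn⟩ := Complex.exp_eq_exp_iff_exists_int.1 heq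
  apply h (-n)
  have h2 : (-2 * Complex.I) * ((θ : ℂ) - φ) = (-2 * Complex.I) * (((-n : ℤ) : ℂ) * Real.pi) := by
    push_cast
    linear_combination hn
  have h3 := mul_left_cancel₀ (by simp) h2
  exact_mod_cast h3

lemma conj_ofReal_mul_exp (t θ : ℝ) :
    starRingEnd ℂ ((t : ℂ) * Complex.exp (Complex.I * θ)) =
      (t : ℂ) * Complex.exp (Complex.I * θ) * Complex.exp (-2 * Complex.I * θ) := by
  rw [map_mul, Complex.conj_ofReal, ← Complex.exp_conj, mul_assoc, ← Complex.exp_add]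
  congr 2
  simp
  ring

/-- If `∑ j, b j z * conj (z - p) ^ e j` vanishes on `E` and, near `p`, every
`b j z * (z - p) ^ e j` is `(z - p) ^ n` times a function `G j` continuous at `p`, then the values
`G j p` satisfy a polynomial equation at `exp (-2 i θ)` for every limiting direction `θ` of `E`
at `p`. -/
lemma LimitingDirection.sum_leadingCoeff_eq_zero {ι : Type*} [Fintype ι] {E : Set ℂ} {p : ℂ}
    {θ : ℝ} (hθ : LimitingDirection E p θ) {e : ι → ℕ} {b G : ι → ℂ → ℂ} {n : ℕ}
    (hE : ∀ z ∈ E, ∑ j, b j z * (starRingEnd ℂ (z - p)) ^ e j = 0)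
    (hG : ∀ j, ContinuousAt (G j) p)
    (hDG : ∀ j, ∀ᶠ z in 𝓝 p, b j z * (z - p) ^ e j = (z - p) ^ n • G j z) :
    ∑ j, Complex.exp (-2 * Complex.I * θ) ^ e j * G j p = 0 := by
  obtain ⟨t, θs, ht0, ht, hθs, hmem⟩ := hθ
  set z : ℕ → ℂ := fun i => p + (t i : ℂ) * Complex.exp (Complex.I * (θs i : ℂ)) with hz
  have hθs' : Tendsto (fun i => (θs i : ℂ)) atTop (𝓝 (θ : ℂ)) :=
    (Complex.continuous_ofReal.tendsto θ).comp hθs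
  have ht' : Tendsto (fun i => (t i : ℂ)) atTop (𝓝 0) := by
    exact_mod_cast (Complex.continuous_ofReal.tendsto 0).comp ht
  have hexp : ∀ c : ℂ, Tendsto (fun i => Complex.exp (c * (θs i : ℂ))) atTop
      (𝓝 (Complex.exp (c * θ))) := fun c =>
    (Complex.continuous_exp.tendsto _).comp (hθs'.const_mul c)
  have hzp : Tendsto z atTop (𝓝 p) := by
    simpa using (ht'.mul (hexp Complex.I)).const_add p
  have hlim : Tendsto (fun i => ∑ j, Complex.exp (-2 * Complex.I * θs i) ^ e j * G j (z i)) atTop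
      (𝓝 (∑ j, Complex.exp (-2 * Complex.I * θ) ^ e j * G j p)) :=
    tendsto_finsetSum _ fun j _ =>
      ((hexp (-2 * Complex.I)).pow (e j)).mul ((hG j).tendsto.comp hzp)
  refine tendsto_nhds_unique (hlim.congr' ?_) tendsto_const_nhds
  filter_upwards [hzp.eventually (eventually_all.2 hDG)] with i hi
  have hw : z i - p = (t i : ℂ) * Complex.exp (Complex.I * (θs i : ℂ)) := by simp [hz]
  have hw0 : z i - p ≠ 0 := by
    rw [hw]
    exact mul_ne_zero (by exact_mod_cast ht0 i) (Complex.exp_ne_zero _)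
  have hsum := hE (z i) (hmem i)
  refine (mul_eq_zero.1 ?_).resolve_left (pow_ne_zero n hw0)
  rw [← hsum, Finset.mul_sum]
  refine Finset.sum_congr rfl fun j _ => ?_
  have h1 : starRingEnd ℂ (z i - p) = (z i - p) * Complex.exp (-2 * Complex.I * θs i) := by
    rw [hw, conj_ofReal_mul_exp]
  have h2 := hi j
  rw [smul_eq_mul] at h2
  rw [h1, mul_pow]
  linear_combination -Complex.exp (-2 * Complex.I * θs i) ^ e j * h2

/-- At a condensation point of order `q`, the holomorphic functions `b j * (z - p) ^ j` attached to
a `q`-analytic function vanishing on `E` vanish to infinite order. -/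
lemma CondensationPoint.analyticOrderAt_eq_top {E : Set ℂ} {p : ℂ} {q : ℕ}
    (h : CondensationPoint E p q) {b : Fin q → ℂ → ℂ} (hb : ∀ j, AnalyticAt ℂ (b j) p)
    (hE : ∀ z ∈ E, ∑ j : Fin q, b j z * (starRingEnd ℂ (z - p)) ^ (j : ℕ) = 0) (j : Fin q) :
    analyticOrderAt (fun z => b j z * (z - p) ^ (j : ℕ)) p = ⊤ := by
  obtain ⟨θ, hθ, hdir⟩ := h
  have hD : ∀ j : Fin q, AnalyticAt ℂ (fun z => b j z * (z - p) ^ (j : ℕ)) p := fun j =>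
    (hb j).mul ((analyticAt_id.sub analyticAt_const).pow _)
  have hle : ∀ n : ℕ, ∀ j : Fin q,
      (n : ℕ∞) ≤ analyticOrderAt (fun z => b j z * (z - p) ^ (j : ℕ)) p := by
    intro n
    induction n with
    | zero => simp
    | succ n ih =>
      choose G hG hDG using fun j => (natCast_le_analyticOrderAt (hD j)).1 (ih j)
      have hinj : Function.Injective fun i => Complex.exp (-2 * Complex.I * θ i) := by
        intro i k hik
        by_contra hne
        exact exp_neg_two_mul_ne (hθ i k hne) hik
      have hzero : (fun j => G j p) = 0 :=
        Matrix.eq_zero_of_forall_index_sum_pow_mul_eq_zero hinj fun i =>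
          (hdir i).sum_leadingCoeff_eq_zero hE (fun j => (hG j).continuousAt) hDG
      intro j
      have hGj : (1 : ℕ∞) ≤ analyticOrderAt (G j) p :=
        Order.one_le_iff_ne_zero.2 ((hG j).analyticOrderAt_ne_zero.2 (congrFun hzero j))
      obtain ⟨H, hH, hGH⟩ := (natCast_le_analyticOrderAt (n := 1) (hG j)).1 (by simpa using hGj)
      refine (natCast_le_analyticOrderAt (hD j)).2 ⟨H, hH, ?_⟩
      filter_upwards [hDG j, hGH] with z h1 h2
      rw [h1, h2, smul_smul, ← pow_add]
  exact ENat.eq_top_iff_forall_ge.2 fun n => hle n j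

theorem q_analytic_unique_continuation_from_condensation_set
    (U : Set ℂ) (hopen : IsOpen U) (hconn : IsConnected U)
    (q : ℕ) (hq : 0 < q)
    (f g : ℂ → ℂ) (hf : QAnalyticOn q f U) (hg : QAnalyticOn q g U)
    (E : Set ℂ) (hE : E ⊆ U)
    (hcond : ∃ p ∈ E, CondensationPoint E p q)
    (heq : ∀ z ∈ E, f z = g z) :
    ∀ z ∈ U, f z = g z := by
  obtain ⟨p, hpE, hcond⟩ := hcond
  obtain ⟨b, hb, hfb⟩ := (hf.sub hg).exists_recentred p
  have hban : ∀ j, AnalyticOnNhd ℂ (b j) U := fun j => (hb j).analyticOnNhd hopen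
  have htop := hcond.analyticOrderAt_eq_top (fun j => hban j p (hE hpE)) fun z hz => by
    rw [← hfb z (hE hz), heq z hz, sub_self]
  intro z hz
  by_cases hzp : z = p
  · exact hzp ▸ heq p hpE
  rw [← sub_eq_zero, hfb z hz]
  refine Finset.sum_eq_zero fun j _ => ?_
  have hDan : AnalyticOnNhd ℂ (fun z => b j z * (z - p) ^ (j : ℕ)) U :=
    (hban j).mul ((analyticOnNhd_id.sub analyticOnNhd_const).pow _)
  have hD := hDan.eqOn_zero_of_preconnected_of_eventuallyEq_zero hconn.isPreconnected (hE hpE)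
    (analyticOrderAt_eq_top.1 (htop j)) hz
  rw [(mul_eq_zero.1 hD).resolve_right (pow_ne_zero _ (sub_ne_zero.2 hzp)), zero_mul]
end
end

section
/- Let 𝒱 ⊆ ℂⁿ be a domain, let α ∈ (ℤ₊)ⁿ, and let Q : 𝒱 → ℂ be a locally bounded function such that for each k ∈ {1,…,n} and each complex line parallel to the z_k-axis, the restriction of Q to every connected component of the intersection of that line with 𝒱 agrees with a polynomial in z_k of degree at most α_k − 1. Then there exist constants a_β ∈ ℂ, indexed by multi-indices β with β_j ≤ α_j − 1 for all j, such that Q(z) = ∑_β a_β·z^β for all z ∈ 𝒱; in particular Q is jointly a polynomial. -/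
noncomputable section

/-- A function on a product of infinite sets which is a polynomial of degree `< α k` in each
variable `z k` separately is a polynomial in all variables jointly. -/
theorem exists_eq_sum_monomials_of_separately_polynomial {K : Type*} [Field K] :
    ∀ (n : ℕ) (S : Fin n → Set K) (_ : ∀ j, (S j).Infinite) (α : Fin n → ℕ)
      (f : (Fin n → K) → K)
      (_ : ∀ (k : Fin n) (c : Fin n → K), (∀ j, c j ∈ S j) →
        ∃ p : Polynomial K, p.natDegree < α k ∧
          ∀ ζ ∈ S k, f (Function.update c k ζ) = p.eval ζ),
      ∃ a : (∀ j : Fin n, Fin (α j)) → K, ∀ z : Fin n → K, (∀ j, z j ∈ S j) →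
        f z = ∑ β : (∀ j : Fin n, Fin (α j)), a β * ∏ j : Fin n, z j ^ (β j : ℕ)
  | 0, _, _, _, f, _ => by
    refine ⟨fun _ => f default, fun z _ => ?_⟩
    simp [Subsingleton.elim z default]
  | n + 1, S, hS, α, f, hf => by
    classical
    obtain ⟨t, htS, htc⟩ := (hS 0).exists_subset_card_eq (α 0)
    have ih : ∀ x ∈ S 0, ∃ a : (∀ j : Fin n, Fin (α j.succ)) → K,
        ∀ z : Fin n → K, (∀ j, z j ∈ S j.succ) →
          f (Fin.cons x z) = ∑ β : (∀ j : Fin n, Fin (α j.succ)),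
            a β * ∏ j : Fin n, z j ^ (β j : ℕ) := by
      intro x hx
      refine exists_eq_sum_monomials_of_separately_polynomial n (fun j => S j.succ)
        (fun j => hS j.succ) (fun j => α j.succ) (fun z => f (Fin.cons x z)) ?_
      intro k c hc
      obtain ⟨p, hp, h⟩ := hf k.succ (Fin.cons x c) (Fin.cases hx hc)
      refine ⟨p, hp, fun ζ hζ => ?_⟩
      rw [← h ζ hζ, Fin.cons_update]
    choose! a ha using ih
    refine ⟨fun β => ∑ x ∈ t, a x (fun j => β j.succ) *
      (Lagrange.basis t id x).coeff (β 0 : ℕ), fun z hz => ?_⟩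
    obtain ⟨p, hp, h⟩ := hf 0 z hz
    have hdeg : p.degree < t.card := by
      rw [htc]
      exact lt_of_le_of_lt Polynomial.degree_le_natDegree (by exact_mod_cast hp)
    have hpi := Lagrange.eq_interpolate (s := t) (v := id) Function.injective_id.injOn hdeg
    have hbasis : ∀ x ∈ t, (Lagrange.basis t id x).eval (z 0) =
        ∑ m : Fin (α 0), (Lagrange.basis t id x).coeff m * z 0 ^ (m : ℕ) := by
      intro x hx
      have hd : (Lagrange.basis t id x).natDegree < α 0 := by
        have hpos : 0 < t.card := Finset.card_pos.2 ⟨x, hx⟩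
        have := Lagrange.degree_basis (s := t) (v := id) Function.injective_id.injOn hx
        rw [Polynomial.natDegree_eq_of_degree_eq_some this]
        omega
      rw [Polynomial.eval_eq_sum_range' hd, Finset.sum_range]
    have hnode : ∀ x ∈ t, p.eval x = ∑ β : (∀ j : Fin n, Fin (α j.succ)),
        a x β * ∏ j : Fin n, z j.succ ^ (β j : ℕ) := by
      intro x hx
      rw [← h x (htS hx), ← ha x (htS hx) (fun j => z j.succ) (fun j => hz j.succ)]
      congr 1
      ext j
      refine Fin.cases ?_ (fun i => ?_) j <;> simp
    have hfz : f z = ∑ x ∈ t, p.eval x * (Lagrange.basis t id x).eval (z 0) := by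
      have h0 := h (z 0) (hz 0)
      rw [Function.update_eq_self] at h0
      rw [h0]
      conv_lhs => rw [hpi]
      simp [Lagrange.interpolate_apply, Polynomial.eval_finsetSum]
    rw [hfz, ← (Fin.consEquiv (fun j => Fin (α j))).sum_comp, Fintype.sum_prod_type]
    simp only [Fin.consEquiv_apply, Fin.cons_zero, Fin.cons_succ, Fin.prod_univ_succ,
      Finset.sum_mul]
    rw [Finset.sum_congr rfl fun m _ => Finset.sum_comm, Finset.sum_comm]
    refine Finset.sum_congr rfl fun x hx => ?_
    rw [hnode x hx, hbasis x hx, Finset.sum_mul_sum, Finset.sum_comm]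
    refine Finset.sum_congr rfl fun m _ => Finset.sum_congr rfl fun β _ => ?_
    ring

/-- A function on a preconnected set which near every point of the set agrees with an entire
function from a given family agrees on the whole set with one member of the family. -/
theorem IsPreconnected.exists_eqOn_of_locally_analytic {E F ι : Type*}
    [NormedAddCommGroup E] [NormedSpace ℂ E] [NormedAddCommGroup F] [NormedSpace ℂ F]
    {s : Set E} (hs : IsPreconnected s) (hne : s.Nonempty) {f : E → F} {P : ι → E → F}
    (hP : ∀ i, AnalyticOnNhd ℂ (P i) Set.univ)
    (hf : ∀ z ∈ s, ∃ i, f =ᶠ[nhds z] P i) :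
    ∃ i, Set.EqOn f (P i) s := by
  obtain ⟨z₀, hz₀⟩ := hne
  obtain ⟨i, hi⟩ := hf z₀ hz₀
  refine ⟨i, fun z hz => ?_⟩
  have hsub : s ⊆ {w | f =ᶠ[nhds w] P i} := by
    refine hs.subset_of_closure_inter_subset isOpen_setOfPred_eventually_nhds ⟨z₀, hz₀, hi⟩ ?_
    rintro w ⟨hwcl, hws⟩
    obtain ⟨j, hj⟩ := hf w hws
    obtain ⟨y, hyj, hyi⟩ := mem_closure_iff_nhds.1 hwcl _ hj.eventually_nhds
    have hji : P j = P i := (hP j).eq_of_eventuallyEq (hP i)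
      ((Filter.EventuallyEq.symm hyj).trans hyi)
    exact hji ▸ hj
  exact Filter.EventuallyEq.eq_of_nhds (hsub hz)

theorem separately_polynomial_is_polynomial
    (n : ℕ) (𝒱 : Set (Fin n → ℂ)) (hopen : IsOpen 𝒱) (hconn : IsConnected 𝒱)
    (α : Fin n → ℕ) (hα : ∀ j, 0 < α j)
    (Q : (Fin n → ℂ) → ℂ)
    -- `Q` is locally bounded on `𝒱`
    (hloc : ∀ z ∈ 𝒱, ∃ ε > (0 : ℝ), ∃ M : ℝ,
      ∀ w ∈ 𝒱, ‖w - z‖ < ε → ‖Q w‖ ≤ M)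
    -- on every connected component of every intersection of `𝒱` with a complex line
    -- parallel to the `z_k`-axis, `Q` agrees with a polynomial in `z_k` of degree
    -- at most `α_k - 1`
    (hsep : ∀ (k : Fin n) (c : Fin n → ℂ) (ζ₀ : ℂ),
      ζ₀ ∈ {ζ : ℂ | Function.update c k ζ ∈ 𝒱} →
      ∃ p : Polynomial ℂ, p.natDegree ≤ α k - 1 ∧
        ∀ ζ ∈ connectedComponentIn {ζ : ℂ | Function.update c k ζ ∈ 𝒱} ζ₀,
          Q (Function.update c k ζ) = p.eval ζ) :
    ∃ a : (∀ j : Fin n, Fin (α j)) → ℂ,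
      ∀ z ∈ 𝒱, Q z = ∑ β : (∀ j : Fin n, Fin (α j)),
        a β * ∏ j : Fin n, z j ^ (β j : ℕ) := by
  refine hconn.isPreconnected.exists_eqOn_of_locally_analytic hconn.nonempty
    (P := fun (a : (∀ j : Fin n, Fin (α j)) → ℂ) z =>
      ∑ β : (∀ j : Fin n, Fin (α j)), a β * ∏ j : Fin n, z j ^ (β j : ℕ)) ?_ ?_
  · intro a z _
    refine Finset.analyticAt_fun_sum _ fun β _ => analyticAt_const.mul
      (Finset.analyticAt_fun_prod _ fun j _ => ?_)
    exact ((ContinuousLinearMap.proj (R := ℂ) (φ := fun _ : Fin n => ℂ) j).analyticAt z).pow _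
  · intro z hz
    obtain ⟨ε, hε, hball⟩ := Metric.isOpen_iff.1 hopen z hz
    have hmem : ∀ w : Fin n → ℂ, (∀ j, w j ∈ Metric.ball (z j) ε) → w ∈ 𝒱 := fun w hw =>
      hball ((dist_pi_lt_iff hε).2 hw)
    obtain ⟨a, ha⟩ := exists_eq_sum_monomials_of_separately_polynomial n
      (fun j => Metric.ball (z j) ε)
      (fun j => infinite_of_mem_nhds (z j) (Metric.ball_mem_nhds _ hε)) α Q (by
        intro k c hc
        have hline : Metric.ball (z k) ε ⊆ {ζ : ℂ | Function.update c k ζ ∈ 𝒱} := by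
          intro ζ hζ
          refine hmem _ fun j => ?_
          rcases eq_or_ne j k with rfl | hjk
          · simpa using hζ
          · simpa [hjk] using hc j
        have hzk : z k ∈ Metric.ball (z k) ε := Metric.mem_ball_self hε
        obtain ⟨p, hp, h⟩ := hsep k c (z k) (hline hzk)
        have := hα k
        exact ⟨p, by omega, fun ζ hζ => h ζ
          ((convex_ball (z k) ε).isPreconnected.subset_connectedComponentIn hzk hline hζ)⟩)
    refine ⟨a, ?_⟩
    filter_upwards [Metric.ball_mem_nhds z hε] with w hw
    exact ha w ((dist_pi_lt_iff hε).1 hw)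
end
end

section
/- Let U ⊆ ℂ be a domain, let f be a q-analytic function on U, let C ≥ 0, and suppose that |f(z)| = C for all z in some nonempty open subset ω ⊆ U. Then there exist a constant λ ∈ ℂ with |λ| = C and a polynomial P of degree at most q−1, not identically zero, such that f(z)·P(z) = λ·conj(P(z)) for all z ∈ U; in particular |f| ≡ C on all of U off the zero set of P. -/
noncomputable section

open Polynomial

/-- Both Wirtinger derivatives of a vanishing sum `∑ A i * conj (B i)` vanish; this is the
antiholomorphic one. -/
theorem sum_mul_conj_deriv_eq_zero {ι : Type*} [Fintype ι] {V : Set ℂ} (hV : IsOpen V)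
    {A B : ι → ℂ → ℂ} (hA : ∀ i, DifferentiableOn ℂ (A i) V)
    (hB : ∀ i, DifferentiableOn ℂ (B i) V)
    (h : ∀ z ∈ V, ∑ i, A i z * starRingEnd ℂ (B i z) = 0) :
    ∀ z ∈ V, ∑ i, A i z * starRingEnd ℂ (deriv (B i) z) = 0 := by
  intro z hz
  have directional (v : ℂ) :
      (∑ i, deriv (A i) z * starRingEnd ℂ (B i z)) * v +
        (∑ i, A i z * starRingEnd ℂ (deriv (B i) z)) * starRingEnd ℂ v = 0 := by
    have hline : HasDerivAt (fun t : ℝ => z + (t : ℂ) * v) v 0 := by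
      simpa using ((Complex.ofRealCLM.hasDerivAt (x := 0)).mul_const v).const_add z
    have hcomp {F : ℂ → ℂ} (hF : DifferentiableOn ℂ F V) :
        HasDerivAt (fun t : ℝ => F (z + (t : ℂ) * v)) (deriv F z * v) 0 := by
      have hFz : HasDerivAt F (deriv F z) (z + ((0 : ℝ) : ℂ) * v) := by
        simpa using (hF.differentiableAt (hV.mem_nhds hz)).hasDerivAt
      exact hFz.comp (0 : ℝ) hline
    have hsum : HasDerivAt
        (fun t : ℝ => ∑ i, A i (z + (t : ℂ) * v) * starRingEnd ℂ (B i (z + (t : ℂ) * v)))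
        (∑ i, (deriv (A i) z * v * starRingEnd ℂ (B i z) +
          A i z * starRingEnd ℂ (deriv (B i) z * v))) 0 := by
      refine HasDerivAt.fun_sum fun i _ => ?_
      convert! (hcomp (hA i)).mul (hcomp (hB i)).star using 1
      simp
    have hzero : (fun t : ℝ => ∑ i, A i (z + (t : ℂ) * v) *
        starRingEnd ℂ (B i (z + (t : ℂ) * v))) =ᶠ[nhds 0] fun _ => 0 := by
      have : ∀ᶠ t : ℝ in nhds 0, z + (t : ℂ) * v ∈ V :=
        hline.continuousAt (hV.mem_nhds (by simpa using hz))
      filter_upwards [this] with t ht using h _ ht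
    have := hsum.unique ((hasDerivAt_const (0 : ℝ) (0 : ℂ)).congr_of_eventuallyEq hzero)
    rw [← this, Finset.sum_add_distrib, Finset.sum_mul, Finset.sum_mul]
    congr 1 <;> refine Finset.sum_congr rfl fun i _ => ?_
    · ring
    · rw [map_mul, mul_assoc]
  have h1 := directional 1
  have hI := directional Complex.I
  simp only [map_one, mul_one, Complex.conj_I] at h1 hI
  linear_combination (1 / 2 : ℂ) * h1 + (Complex.I / 2) * hI +
    (-(∑ i, deriv (A i) z * starRingEnd ℂ (B i z)) / 2 +
      (∑ i, A i z * starRingEnd ℂ (deriv (B i) z)) / 2) * Complex.I_mul_I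

/-- Polarization: a sum `∑ A i z * conj (B i w)` of holomorphic times antiholomorphic functions
vanishing on the diagonal of a domain vanishes identically. -/
theorem sum_mul_conj_eq_zero_of_diagonal {ι : Type*} [Fintype ι] {V : Set ℂ} (hV : IsOpen V)
    (hVc : IsPreconnected V) {A B : ι → ℂ → ℂ} (hA : ∀ i, DifferentiableOn ℂ (A i) V)
    (hB : ∀ i, DifferentiableOn ℂ (B i) V)
    (h : ∀ z ∈ V, ∑ i, A i z * starRingEnd ℂ (B i z) = 0) :
    ∀ z ∈ V, ∀ w ∈ V, ∑ i, A i z * starRingEnd ℂ (B i w) = 0 := by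
  have hBn (n : ℕ) (i : ι) : DifferentiableOn ℂ (iteratedDeriv n (B i)) V := by
    rw [iteratedDeriv_eq_iterate]
    exact (((hB i).analyticOnNhd hV).iterated_deriv n).differentiableOn
  have hn (n : ℕ) : ∀ z ∈ V, ∑ i, A i z * starRingEnd ℂ (iteratedDeriv n (B i) z) = 0 := by
    induction n with
    | zero => simpa using h
    | succ n ih =>
      simp only [iteratedDeriv_succ]
      exact sum_mul_conj_deriv_eq_zero hV hA (hBn n) ih
  intro z hz w hw
  set g : ℂ → ℂ := fun u => ∑ i, starRingEnd ℂ (A i z) * B i u with hg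
  have hgan : AnalyticOnNhd ℂ g V :=
    (DifferentiableOn.fun_sum fun i _ => (hB i).const_mul _).analyticOnNhd hV
  have hgn (n : ℕ) : iteratedDeriv n g z = 0 := by
    have hcd (i : ι) : ContDiffAt ℂ n (B i) z := ((hB i).analyticOnNhd hV z hz).contDiffAt
    rw [hg, iteratedDeriv_fun_sum fun i _ => contDiffAt_const.mul (hcd i)]
    simp only [iteratedDeriv_const_mul_field]
    simpa using congrArg (starRingEnd ℂ) (hn n z hz)
  have htop : analyticOrderAt g z = ⊤ := by
    refine top_le_iff.mp (ENat.forall_natCast_le_iff_le.mp fun n _ => ?_)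
    exact (natCast_le_analyticOrderAt_iff_iteratedDeriv_eq_zero (hgan z hz)).2 fun i _ => hgn i
  have := hgan.eqOn_zero_of_preconnected_of_eventuallyEq_zero hVc hz
    (analyticOrderAt_eq_top.1 htop) hw
  simpa [hg] using congrArg (starRingEnd ℂ) this

/-- The polynomial `∑ a j z X ^ j`, whose value at `conj z` is that of the polyanalytic function
with components `a`. -/
def componentPolynomial {q : ℕ} (a : Fin q → ℂ → ℂ) (z : ℂ) : ℂ[X] :=
  ∑ j : Fin q, C (a j z) * X ^ (j : ℕ)

theorem eval_componentPolynomial {q : ℕ} (a : Fin q → ℂ → ℂ) (z x : ℂ) :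
    (componentPolynomial a z).eval x = ∑ j : Fin q, a j z * x ^ (j : ℕ) := by
  simp [componentPolynomial, eval_finsetSum]

theorem degree_componentPolynomial_lt {q : ℕ} (a : Fin q → ℂ → ℂ) (z : ℂ) :
    (componentPolynomial a z).degree < q :=
  degree_sum_fin_lt _

theorem eval_map_conj (p : ℂ[X]) (z : ℂ) :
    (p.map (starRingEnd ℂ)).eval z = starRingEnd ℂ (p.eval (starRingEnd ℂ z)) := by
  rw [← eval₂_hom, Complex.conj_conj, eval_map]

theorem infinite_of_isOpen_complex {V : Set ℂ} (hV : IsOpen V) (hne : V.Nonempty) : V.Infinite :=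
  hne.elim fun _ hz => infinite_of_mem_nhds _ (hV.mem_nhds hz)

theorem eq_of_eval_conj_eq {V : Set ℂ} (hV : V.Infinite) {p r : ℂ[X]}
    (h : ∀ w ∈ V, p.eval (starRingEnd ℂ w) = r.eval (starRingEnd ℂ w)) : p = r := by
  refine eq_of_infinite_eval_eq p r
    ((hV.image (f := starRingEnd ℂ) (starRingEnd ℂ).injective.injOn).mono ?_)
  rintro _ ⟨w, hw, rfl⟩
  exact h w hw

/-- Uniqueness for polyanalytic functions. -/
theorem components_eq_zero_of_eq_zero_on_open {U : Set ℂ} (hopen : IsOpen U)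
    (hconn : IsPreconnected U) {q : ℕ} {a : Fin q → ℂ → ℂ}
    (ha : ∀ j, DifferentiableOn ℂ (a j) U) {V : Set ℂ} (hV : IsOpen V) (hVc : IsPreconnected V)
    (hVne : V.Nonempty) (hVU : V ⊆ U)
    (h : ∀ z ∈ V, ∑ j : Fin q, a j z * (starRingEnd ℂ z) ^ (j : ℕ) = 0) :
    ∀ j, ∀ z ∈ U, a j z = 0 := by
  have hpol := sum_mul_conj_eq_zero_of_diagonal hV hVc (fun j => (ha j).mono hVU)
    (B := fun (j : Fin q) z => z ^ (j : ℕ)) (fun j => (differentiable_pow (j : ℕ)).differentiableOn)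
    (by simpa using h)
  have hzero : ∀ z ∈ V, componentPolynomial a z = 0 := fun z hz =>
    eq_of_eval_conj_eq (infinite_of_isOpen_complex hV hVne) fun w hw => by
      simpa [eval_componentPolynomial] using hpol z hz w hw
  obtain ⟨c, hc⟩ := hVne
  intro j
  refine ((ha j).analyticOnNhd hopen).eqOn_zero_of_preconnected_of_eventuallyEq_zero hconn
    (hVU hc) ?_
  filter_upwards [hV.mem_nhds hc] with z hz
  have := congrArg (fun p : ℂ[X] => p.coeff (j : ℕ)) (hzero z hz)
  simpa [componentPolynomial, finsetSum_coeff, coeff_X_pow, Fin.val_inj] using this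

/-- If `p z` and `p w` are reciprocal up to the constant `K` at conjugate points, and degrees are
bounded, then all the `p z` divide one nonzero polynomial. -/
theorem exists_common_multiple_of_reciprocal {V : Set ℂ} (hV : V.Infinite) {q : ℕ} {p : ℂ → ℂ[X]}
    (hdeg : ∀ z, (p z).degree < q) {K : ℂ} (hK : K ≠ 0)
    (h : ∀ z ∈ V, ∀ w ∈ V, (p z).eval (starRingEnd ℂ w) *
      starRingEnd ℂ ((p w).eval (starRingEnd ℂ z)) = K) :
    ∃ D : ℂ[X], D ≠ 0 ∧ ∀ z ∈ V, p z ∣ D := by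
  classical
  have hp0 : ∀ z ∈ V, p z ≠ 0 := fun z hz h0 => hK (by simpa [h0] using (h z hz z hz).symm)
  obtain ⟨s, hsV, hcard⟩ := hV.exists_subset_card_eq q
  refine ⟨∏ i ∈ s, p i, Finset.prod_ne_zero_iff.2 fun i hi => hp0 i (hsV hi), fun z hz => ?_⟩
  refine ⟨∑ i ∈ s, C ((Lagrange.basis s id i).eval z) * ∏ k ∈ s.erase i, p k, ?_⟩
  refine eq_of_eval_conj_eq hV fun w hw => ?_
  set Q := (p w).map (starRingEnd ℂ) with hQ
  have hinterp : Q.eval z =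
      ∑ i ∈ s, Q.eval i * (Lagrange.basis s id i).eval z := by
    have hQdeg : Q.degree < s.card := by
      rw [hQ, degree_map, hcard]
      exact hdeg w
    conv_lhs => rw [Lagrange.eq_interpolate (v := id) Function.injective_id.injOn hQdeg]
    simp [Lagrange.interpolate_apply, eval_finsetSum]
  have hval : ∀ u ∈ V, (p u).eval (starRingEnd ℂ w) * Q.eval u = K := fun u hu => by
    rw [hQ, eval_map_conj]
    exact h u hu w hw
  refine mul_left_cancel₀ hK ?_
  rw [eval_mul, eval_finsetSum]
  have hterm : ∀ i ∈ s, K * ((C ((Lagrange.basis s id i).eval z) *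
      ∏ k ∈ s.erase i, p k).eval (starRingEnd ℂ w)) =
      (∏ k ∈ s, p k).eval (starRingEnd ℂ w) *
        (Q.eval i * (Lagrange.basis s id i).eval z) := fun i hi => by
    rw [← Finset.mul_prod_erase s p hi, ← hval i (hsV hi)]
    simp only [eval_mul, eval_C]
    ring
  rw [mul_left_comm, Finset.mul_sum, Finset.sum_congr rfl hterm, ← Finset.mul_sum, ← hinterp,
    ← hval z hz]
  ring

/-- A continuous family of divisors of a fixed nonzero polynomial is constant up to scalars. -/
theorem eval_mul_eval_eq_of_dvd {V : Set ℂ} (hVc : IsPreconnected V) {p : ℂ → ℂ[X]}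
    (hcont : ∀ x, ContinuousOn (fun z => (p z).eval x) V) {x₀ : ℂ}
    (hx₀ : ∀ z ∈ V, (p z).eval x₀ ≠ 0) {D : ℂ[X]} (hD : D ≠ 0) (hdvd : ∀ z ∈ V, p z ∣ D) :
    ∀ z ∈ V, ∀ w ∈ V, ∀ x, (p z).eval x * (p w).eval x₀ = (p w).eval x * (p z).eval x₀ := by
  intro z hz w hw x
  have hfin : {g : ℂ[X] | g.Monic ∧ g ∣ D}.Finite :=
    @Set.toFinite _ _ (@Finite.of_fintype _ (fintypeSubtypeMonicDvd D hD))
  have himage : (fun z => (p z).eval x / (p z).eval x₀) '' V ⊆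
      (fun g : ℂ[X] => g.eval x / g.eval x₀) '' {g | g.Monic ∧ g ∣ D} := by
    rintro _ ⟨u, hu, rfl⟩
    have hu0 : p u ≠ 0 := fun h0 => hx₀ u hu (by simp [h0])
    have hlc : (p u).leadingCoeff⁻¹ ≠ 0 := inv_ne_zero (leadingCoeff_ne_zero.2 hu0)
    refine ⟨p u * C (p u).leadingCoeff⁻¹, ⟨monic_mul_leadingCoeff_inv hu0, ?_⟩, ?_⟩
    · exact ((isUnit_C.2 hlc.isUnit).mul_right_dvd).2 (hdvd u hu)
    · simp only [eval_mul, eval_C]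
      exact mul_div_mul_right _ _ hlc
  have hconst := ((hfin.image _).subset himage).countable.isTotallyDisconnected _ subset_rfl
    (hVc.image _ ((hcont x).div (hcont x₀) hx₀)) ⟨z, hz, rfl⟩ ⟨w, hw, rfl⟩
  exact (div_eq_div_iff (hx₀ z hz) (hx₀ w hw)).1 hconst

theorem constant_modulus_on_open_subset_propagates
    (U : Set ℂ) (hopen : IsOpen U) (hconn : IsConnected U)
    (q : ℕ) (hq : 0 < q)
    (f : ℂ → ℂ) (hf : QAnalyticOn q f U)
    (C : ℝ) (hC : 0 ≤ C)
    (ω : Set ℂ) (hω : ω.Nonempty) (hωopen : IsOpen ω) (hωU : ω ⊆ U)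
    (hmod : ∀ z ∈ ω, ‖f z‖ = C) :
    ∃ (lam : ℂ) (P : Polynomial ℂ), ‖lam‖ = C ∧ P ≠ 0 ∧ P.natDegree ≤ q - 1 ∧
      (∀ z ∈ U, f z * P.eval z = lam * starRingEnd ℂ (P.eval z)) ∧
      (∀ z ∈ U, P.eval z ≠ 0 → ‖f z‖ = C) := by
  suffices H : ∃ (lam : ℂ) (P : Polynomial ℂ), ‖lam‖ = C ∧ P ≠ 0 ∧ P.natDegree ≤ q - 1 ∧
      ∀ z ∈ U, f z * P.eval z = lam * starRingEnd ℂ (P.eval z) by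
    obtain ⟨lam, P, hlam, hP, hdeg, hfP⟩ := H
    refine ⟨lam, P, hlam, hP, hdeg, hfP, fun z hz hPz => ?_⟩
    have := congrArg norm (hfP z hz)
    rw [norm_mul, norm_mul, RCLike.norm_conj, hlam] at this
    exact mul_right_cancel₀ (norm_ne_zero_iff.2 hPz) this
  obtain ⟨a, ha, hfa⟩ := hf
  obtain ⟨c, hc⟩ := hω
  obtain ⟨r, hr, hball⟩ := Metric.isOpen_iff.1 hωopen c hc
  set V := Metric.ball c r
  have hV : IsOpen V := Metric.isOpen_ball
  have hVc : IsPreconnected V := (convex_ball c r).isPreconnected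
  have hcV : c ∈ V := Metric.mem_ball_self hr
  have hVU : V ⊆ U := hball.trans hωU
  rcases hC.eq_or_lt with rfl | hCpos
  · refine ⟨0, 1, by simp, one_ne_zero, by simp, fun z hz => ?_⟩
    have h0 := components_eq_zero_of_eq_zero_on_open hopen hconn.isPreconnected ha hV hVc ⟨c, hcV⟩
      hVU fun z hz => by rw [← hfa z (hVU hz)]; exact norm_eq_zero.1 (hmod z (hball hz))
    simp [hfa z hz, h0 _ z hz]
  set p := componentPolynomial a with hp
  have hfp : ∀ z ∈ U, f z = (p z).eval (starRingEnd ℂ z) := fun z hz => by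
    rw [hfa z hz, hp, eval_componentPolynomial]
  have hrec : ∀ z ∈ V, ∀ w ∈ V, (p z).eval (starRingEnd ℂ w) *
      starRingEnd ℂ ((p w).eval (starRingEnd ℂ z)) = (C : ℂ) ^ 2 := by
    have expand (z w : ℂ) : ∑ i : Option (Fin q × Fin q),
        (i.elim (fun _ => -(C : ℂ) ^ 2) fun i z => a i.1 z * z ^ (i.2 : ℕ) : ℂ → ℂ) z *
          starRingEnd ℂ ((i.elim (fun _ => 1) fun i z => a i.2 z * z ^ (i.1 : ℕ) : ℂ → ℂ) w) =
        (p z).eval (starRingEnd ℂ w) * starRingEnd ℂ ((p w).eval (starRingEnd ℂ z)) -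
          (C : ℂ) ^ 2 := by
      simp only [hp, eval_componentPolynomial, Fintype.sum_option, Option.elim, map_sum, map_mul,
        map_pow, Complex.conj_conj, map_one, mul_one, Finset.sum_mul_sum, Fintype.sum_prod_type]
      rw [neg_add_eq_sub]
      congr 1
      refine Finset.sum_congr rfl fun i _ => Finset.sum_congr rfl fun j _ => ?_
      ring
    intro z hz w hw
    refine sub_eq_zero.1 ((expand z w).symm.trans
      (sum_mul_conj_eq_zero_of_diagonal hV hVc ?_ ?_ ?_ z hz w hw))
    · rintro (_ | i)
      · exact differentiableOn_const _
      · exact ((ha i.1).mono hVU).mul (differentiable_pow _).differentiableOn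
    · rintro (_ | i)
      · exact differentiableOn_const _
      · exact ((ha i.2).mono hVU).mul (differentiable_pow _).differentiableOn
    · intro u hu
      rw [expand u u, ← hfp u (hVU hu), Complex.mul_conj', hmod u (hball hu), sub_self]
  have hK : (C : ℂ) ^ 2 ≠ 0 := pow_ne_zero _ (Complex.ofReal_ne_zero.2 hCpos.ne')
  obtain ⟨D, hD, hdvd⟩ := exists_common_multiple_of_reciprocal
    (infinite_of_isOpen_complex hV ⟨c, hcV⟩) (degree_componentPolynomial_lt a) hK hrec
  have hx₀ : ∀ z ∈ V, (p z).eval (starRingEnd ℂ c) ≠ 0 := fun z hz h0 =>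
    hK (by rw [← hrec z hz c hcV, h0, zero_mul])
  have hcont (x : ℂ) : ContinuousOn (fun z => (p z).eval x) V := by
    simp only [hp, eval_componentPolynomial]
    exact continuousOn_finsetSum _ fun j _ => ((ha j).mono hVU).continuousOn.mul_const _
  have hprop := eval_mul_eval_eq_of_dvd hVc hcont hx₀ hD hdvd
  set lam : ℂ := (C : ℂ) ^ 2 / f c with hlam
  set P := (p c).map (starRingEnd ℂ) with hP
  have hpc : p c ≠ 0 := fun h0 => hx₀ c hcV (by simp [h0])
  have hfc : f c ≠ 0 := by simpa [hfp c (hVU hcV)] using hx₀ c hcV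
  refine ⟨lam, P, ?_, (Polynomial.map_ne_zero_iff (starRingEnd ℂ).injective).2 hpc, ?_, ?_⟩
  · rw [hlam, norm_div, hmod c hc, norm_pow, Complex.norm_real, Real.norm_of_nonneg hC, sq,
      mul_div_cancel_right₀ _ hCpos.ne']
  · rw [hP, natDegree_map]
    exact Nat.le_sub_one_of_lt ((natDegree_lt_iff_degree_lt hpc).2
      (degree_componentPolynomial_lt a c))
  have hPz (z : ℂ) : starRingEnd ℂ (P.eval z) = (p c).eval (starRingEnd ℂ z) := by
    rw [hP, eval_map_conj, Complex.conj_conj]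
  have hlocal : ∀ z ∈ V, f z * P.eval z = lam * starRingEnd ℂ (P.eval z) := fun z hz => by
    have h1 := hprop z hz c hcV (starRingEnd ℂ z)
    have h2 := hrec z hz c hcV
    rw [← hfp z (hVU hz), ← hfp c (hVU hcV)] at h1
    rw [← eval_map_conj, ← hP] at h2
    rw [hPz, hlam, div_mul_eq_mul_div, eq_div_iff hfc, ← h2]
    linear_combination P.eval z * h1
  have hdiff (z : ℂ) (hz : z ∈ U) :
      ∑ j : Fin q, (a j z * P.eval z - lam * a j c) * (starRingEnd ℂ z) ^ (j : ℕ) =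
        f z * P.eval z - lam * starRingEnd ℂ (P.eval z) := by
    rw [hPz, hfa z hz, hp, eval_componentPolynomial, Finset.sum_mul, Finset.mul_sum,
      ← Finset.sum_sub_distrib]
    refine Finset.sum_congr rfl fun j _ => ?_
    ring
  have hzero := components_eq_zero_of_eq_zero_on_open hopen hconn.isPreconnected
    (a := fun j z => a j z * P.eval z - lam * a j c)
    (fun j => ((ha j).mul P.differentiable.differentiableOn).sub_const _) hV hVc ⟨c, hcV⟩ hVU
    fun z hz => by rw [hdiff z (hVU hz), hlocal z hz, sub_self]
  intro z hz
  refine sub_eq_zero.1 ((hdiff z hz).symm.trans (Finset.sum_eq_zero fun j _ => ?_))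
  rw [hzero j z hz, zero_mul]
end
end

section
/- Let A : ℂⁿ → ℂⁿ be an invertible ℂ-linear map, let Ω ⊆ ℂⁿ be open, let α ∈ (ℤ₊)ⁿ, and let f be an α-analytic function on Ω. Set m := ∑_{j=1}^{n}(α_j − 1). Then the function w ↦ f(A·w) is β-analytic on A⁻¹(Ω), where β = (m+1, m+1, …, m+1); in particular, composing an α-analytic function with an invertible complex-linear change of coordinates yields a polyanalytic function of some order depending only on α. -/
noncomputable section

section CommutingEndomorphisms

variable {R M : Type*} [CommRing R] [AddCommGroup M] [Module R M]

theorem Module.End.add_pow_apply_eq_zero {a b : Module.End R M} (h : Commute a b) {x : M}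
    {p q k : ℕ} (ha : (a ^ p) x = 0) (hb : (b ^ q) x = 0) (hk : p + q ≤ k + 1) :
    ((a + b) ^ k) x = 0 := by
  have hpow : ∀ {c : Module.End R M} {r s : ℕ}, (c ^ r) x = 0 → r ≤ s → (c ^ s) x = 0 := by
    intro c r s hc hrs
    rw [← Nat.sub_add_cancel hrs, pow_add, Module.End.mul_apply, hc, map_zero]
  rw [h.add_pow, LinearMap.sum_apply]
  refine Finset.sum_eq_zero fun i _ => ?_
  rw [← (Nat.cast_commute (k.choose i) (a ^ i * b ^ (k - i))).eq, Module.End.mul_apply]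
  suffices (a ^ i * b ^ (k - i)) x = 0 by rw [this, map_zero]
  rcases le_or_gt p i with hi | hi
  · rw [(h.pow_pow i (k - i)).eq, Module.End.mul_apply, hpow ha hi, map_zero]
  · rw [Module.End.mul_apply, hpow hb (by omega), map_zero]

theorem Module.End.sum_pow_apply_eq_zero {ι : Type*} (s : Finset ι) (d : ι → Module.End R M)
    (hd : ∀ i j, Commute (d i) (d j)) (α : ι → ℕ) (hα : ∀ i, 0 < α i) {x : M}
    (hx : ∀ i, (d i ^ α i) x = 0) :
    ((∑ i ∈ s, d i) ^ (∑ i ∈ s, (α i - 1) + 1)) x = 0 := by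
  classical
  induction s using Finset.induction_on with
  | empty => simp
  | insert i s his ih =>
    rw [Finset.sum_insert his, Finset.sum_insert his]
    refine add_pow_apply_eq_zero (Commute.sum_right _ _ _ fun j _ => hd i j) (hx i) ih ?_
    have := hα i
    omega

end CommutingEndomorphisms

section SmoothOn

variable {E : Type*} [NormedAddCommGroup E] [NormedSpace ℝ E]

/-- The functions that are smooth on `Ω`, normalized to vanish outside `Ω`. -/
def smoothOn (Ω : Set E) : Submodule ℂ (E → ℂ) where
  carrier := {f | ContDiffOn ℝ (⊤ : ℕ∞) f Ω ∧ ∀ z ∉ Ω, f z = 0}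
  zero_mem' := ⟨contDiffOn_const, fun _ _ => rfl⟩
  add_mem' hf hg := ⟨hf.1.add hg.1, fun z hz => by simp [hf.2 z hz, hg.2 z hz]⟩
  smul_mem' c _ hf := ⟨hf.1.const_smul c, fun z hz => by simp [hf.2 z hz]⟩

variable {Ω : Set E}

theorem smoothOn.differentiableAt (hΩ : IsOpen Ω) (f : smoothOn Ω) {z : E} (hz : z ∈ Ω) :
    DifferentiableAt ℝ (f : E → ℂ) z :=
  (f.2.1.contDiffAt (hΩ.mem_nhds hz)).differentiableAt (by simp)

theorem smoothOn.ext_on {f g : smoothOn Ω} (h : ∀ z ∈ Ω, f.1 z = g.1 z) : f = g := by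
  refine Subtype.ext (funext fun z => ?_)
  by_cases hz : z ∈ Ω
  · exact h z hz
  · rw [f.2.2 z hz, g.2.2 z hz]

/-- The real directional derivative in the direction `v`, acting on smooth functions on `Ω`. -/
def dirDeriv (hΩ : IsOpen Ω) (v : E) : Module.End ℂ (smoothOn Ω) where
  toFun f := ⟨Ω.indicator fun z => fderiv ℝ (f : E → ℂ) z v,
    ((f.2.1.fderiv_of_isOpen hΩ (by simp)).clm_apply contDiffOn_const).congr
      fun z hz => Set.indicator_of_mem hz _,
    fun z hz => Set.indicator_of_notMem hz _⟩
  map_add' f g := smoothOn.ext_on fun z hz => by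
    simp [hz, fderiv_add (smoothOn.differentiableAt hΩ f hz) (smoothOn.differentiableAt hΩ g hz)]
  map_smul' c f := smoothOn.ext_on fun z hz => by
    simp [hz, fderiv_const_smul (smoothOn.differentiableAt hΩ f hz)]

theorem dirDeriv_apply (hΩ : IsOpen Ω) (v : E) (f : smoothOn Ω) {z : E} (hz : z ∈ Ω) :
    (dirDeriv hΩ v f).1 z = fderiv ℝ f.1 z v := by
  simp [dirDeriv, hz]

theorem dirDeriv_add (hΩ : IsOpen Ω) (v w : E) :
    dirDeriv hΩ (v + w) = dirDeriv hΩ v + dirDeriv hΩ w :=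
  LinearMap.ext fun f => smoothOn.ext_on fun z hz => by simp [dirDeriv, hz]

theorem dirDeriv_real_smul (hΩ : IsOpen Ω) (r : ℝ) (v : E) :
    dirDeriv hΩ (r • v) = (r : ℂ) • dirDeriv hΩ v :=
  LinearMap.ext fun f => smoothOn.ext_on fun z hz => by simp [dirDeriv, hz]

theorem fderiv_dirDeriv (hΩ : IsOpen Ω) (v w : E) (f : smoothOn Ω) {z : E} (hz : z ∈ Ω) :
    fderiv ℝ (dirDeriv hΩ w f).1 z v = fderiv ℝ (fderiv ℝ f.1) z v w := by
  have h : (dirDeriv hΩ w f).1 =ᶠ[nhds z] fun y => fderiv ℝ f.1 y w :=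
    Set.EqOn.eventuallyEq_of_mem (fun y hy => dirDeriv_apply hΩ w f hy) (hΩ.mem_nhds hz)
  have hd : DifferentiableAt ℝ (fderiv ℝ f.1) z :=
    (((f.2.1.fderiv_of_isOpen (m := 1) hΩ (by norm_cast)).contDiffAt
      (hΩ.mem_nhds hz))).differentiableAt (by simp)
  rw [h.fderiv_eq, fderiv_clm_apply hd (differentiableAt_const w)]
  simp

theorem dirDeriv_commute (hΩ : IsOpen Ω) (v w : E) :
    Commute (dirDeriv hΩ v) (dirDeriv hΩ w) :=
  LinearMap.ext fun f => smoothOn.ext_on fun z hz => by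
    rw [Module.End.mul_apply, Module.End.mul_apply, dirDeriv_apply hΩ _ _ hz,
      dirDeriv_apply hΩ _ _ hz, fderiv_dirDeriv hΩ _ _ _ hz, fderiv_dirDeriv hΩ _ _ _ hz]
    refine ((f.2.1.contDiffAt (hΩ.mem_nhds hz)).isSymmSndFDerivAt ?_).eq v w
    rw [minSmoothness_of_isRCLikeNormedField]
    norm_cast

end SmoothOn

section DBar

variable {E F : Type*} [NormedAddCommGroup E] [NormedSpace ℂ E] [NormedSpace ℝ E]
  [NormedAddCommGroup F] [NormedSpace ℂ F] [NormedSpace ℝ F] {Ω : Set E}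

/-- The Wirtinger derivative of `f` in the direction `v`. -/
def dbar (v : E) (f : E → ℂ) : E → ℂ :=
  fun z => (1 / 2 : ℂ) * (fderiv ℝ f z v + Complex.I * fderiv ℝ f z (Complex.I • v))

theorem wirtingerBar_eq_dbar (n : ℕ) (j : Fin n) :
    wirtingerBar n j = dbar (Pi.single j (1 : ℂ)) := by
  funext f z
  rw [wirtingerBar, dbar, ← Pi.single_smul, smul_eq_mul, mul_one]

theorem dbar_comp_equiv (A : E ≃L[ℝ] F) (hA : ∀ v, A (Complex.I • v) = Complex.I • A v) (v : E)
    (f : F → ℂ) : dbar v (f ∘ A) = dbar (A v) f ∘ A := by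
  funext z
  simp [dbar, A.comp_right_fderiv, hA]

theorem iterate_dbar_comp_equiv (A : E ≃L[ℝ] F)
    (hA : ∀ v, A (Complex.I • v) = Complex.I • A v) (v : E) (k : ℕ) (f : F → ℂ) :
    (dbar v)^[k] (f ∘ A) = (dbar (A v))^[k] f ∘ A := by
  induction k generalizing f with
  | zero => rfl
  | succ k ih => rw [Function.iterate_succ_apply, dbar_comp_equiv A hA, ih,
      Function.iterate_succ_apply]

theorem Set.EqOn.dbar (hΩ : IsOpen Ω) {f g : E → ℂ} (h : Set.EqOn f g Ω) (v : E) :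
    Set.EqOn (dbar v f) (dbar v g) Ω := fun z hz => by
  rw [_root_.dbar, _root_.dbar, (h.eventuallyEq_of_mem (hΩ.mem_nhds hz)).fderiv_eq]

/-- The Wirtinger derivative in the direction `v`, acting on smooth functions on `Ω`. -/
def dbarEnd (hΩ : IsOpen Ω) (v : E) : Module.End ℂ (smoothOn Ω) :=
  (1 / 2 : ℂ) • (dirDeriv hΩ v + Complex.I • dirDeriv hΩ (Complex.I • v))

theorem dbarEnd_commute (hΩ : IsOpen Ω) (v w : E) :
    Commute (dbarEnd hΩ v) (dbarEnd hΩ w) := by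
  have h := dirDeriv_commute hΩ
  exact Commute.smul_left (Commute.smul_right
    (((h _ _).add_right ((h _ _).smul_right _)).add_left
      (((h _ _).add_right ((h _ _).smul_right _)).smul_left _)) _) _

theorem dbarEnd_add (hΩ : IsOpen Ω) (v w : E) :
    dbarEnd hΩ (v + w) = dbarEnd hΩ v + dbarEnd hΩ w := by
  simp only [dbarEnd, smul_add, dirDeriv_add]
  abel

theorem dbarEnd_smul [IsScalarTower ℝ ℂ E] (hΩ : IsOpen Ω) (c : ℂ) (v : E) :
    dbarEnd hΩ (c • v) = (starRingEnd ℂ c) • dbarEnd hΩ v := by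
  have h1 : c • v = c.re • v + c.im • (Complex.I • v) := by
    rw [← smul_assoc, ← algebraMap_smul ℂ c.re v, ← add_smul]
    congr 1
    simp
  have h2 : Complex.I • c • v = c.re • (Complex.I • v) + (-c.im) • v := by
    rw [← smul_assoc, ← smul_assoc, ← algebraMap_smul ℂ (-c.im) v, ← add_smul]
    congr 1
    apply Complex.ext <;> simp
  have h3 : starRingEnd ℂ c = c.re - c.im * Complex.I := by
    apply Complex.ext <;> simp
  rw [dbarEnd, h2, h1, dbarEnd, h3]
  simp only [dirDeriv_add, dirDeriv_real_smul, Complex.ofReal_neg]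
  match_scalars
  · ring
  · linear_combination ((c.im : ℂ) / 2) * Complex.I_sq

theorem dbarEnd_pow_eqOn (hΩ : IsOpen Ω) (v : E) (f : smoothOn Ω) (k : ℕ) :
    Set.EqOn ((dbarEnd hΩ v ^ k) f).1 ((dbar v)^[k] f.1) Ω := by
  induction k with
  | zero => exact fun _ _ => rfl
  | succ k ih =>
    rw [pow_succ', Function.iterate_succ_apply', Module.End.mul_apply]
    refine Set.EqOn.trans (fun z hz => ?_) (ih.dbar hΩ v)
    rw [dbarEnd, LinearMap.smul_apply, LinearMap.add_apply, LinearMap.smul_apply, dbar,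
      ← dirDeriv_apply hΩ _ _ hz, ← dirDeriv_apply hΩ _ _ hz]
    rfl

end DBar

theorem dbarEnd_eq_sum {n : ℕ} {Ω : Set (Fin n → ℂ)} (hΩ : IsOpen Ω) (v : Fin n → ℂ) :
    dbarEnd hΩ v = ∑ k, (starRingEnd ℂ (v k)) • dbarEnd hΩ (Pi.single k (1 : ℂ)) := by
  let D : (Fin n → ℂ) →ₛₗ[starRingEnd ℂ] Module.End ℂ (smoothOn Ω) :=
    { toFun := dbarEnd hΩ, map_add' := dbarEnd_add hΩ, map_smul' := dbarEnd_smul hΩ }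
  conv_lhs => rw [pi_eq_sum_univ' v]
  refine (map_sum D _ _).trans (Finset.sum_congr rfl fun k _ => ?_)
  rw [map_smulₛₗ]
  rfl

theorem polyanalytic_comp_linear
    (n : ℕ) (A : (Fin n → ℂ) →ₗ[ℂ] (Fin n → ℂ)) (hA : Function.Bijective A)
    (Ω : Set (Fin n → ℂ)) (hopen : IsOpen Ω)
    (α : Fin n → ℕ) (hα : ∀ j, 0 < α j)
    (f : (Fin n → ℂ) → ℂ) (hf : PolyanalyticOn n α f Ω) :
    PolyanalyticOn n (fun _ => (∑ j : Fin n, (α j - 1)) + 1)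
      (fun w => f (A w)) (⇑A ⁻¹' Ω) := by
  let B : (Fin n → ℂ) ≃L[ℝ] (Fin n → ℂ) :=
    ((LinearEquiv.ofBijective A hA).restrictScalars ℝ).toContinuousLinearEquiv
  have hBI (v) : B (Complex.I • v) = Complex.I • B v := A.map_smul _ _
  refine ⟨hf.1.comp B.contDiff.contDiffOn fun _ hz => hz, fun j z hz => ?_⟩
  rw [wirtingerBar_eq_dbar]
  refine (congrFun (iterate_dbar_comp_equiv B hBI (Pi.single j 1) _ f) z).trans ?_
  set v := B (Pi.single j 1)
  let g : smoothOn Ω := ⟨Ω.indicator f, hf.1.congr fun z hz => Set.indicator_of_mem hz _,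
    fun z hz => Set.indicator_of_notMem hz _⟩
  have hgf (u : Fin n → ℂ) (k : ℕ) : Set.EqOn ((dbarEnd hopen u ^ k) g).1 ((dbar u)^[k] f) Ω := by
    refine (dbarEnd_pow_eqOn hopen u g k).trans ?_
    induction k with
    | zero => exact fun z hz => Set.indicator_of_mem hz _
    | succ k ih =>
      rw [Function.iterate_succ_apply', Function.iterate_succ_apply']
      exact ih.dbar hopen u
  refine (hgf v _ hz).symm.trans ?_
  rw [dbarEnd_eq_sum, Module.End.sum_pow_apply_eq_zero _ _ _ α hα]
  · rfl
  · intro k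
    rw [smul_pow, LinearMap.smul_apply]
    rw [show (dbarEnd hopen (Pi.single k (1 : ℂ)) ^ α k) g = 0 from ?_, smul_zero]
    refine smoothOn.ext_on fun y hy => ?_
    rw [hgf _ _ hy, ← wirtingerBar_eq_dbar]
    exact hf.2 k y hy
  · exact fun k l => ((dbarEnd_commute hopen _ _).smul_right _).smul_left _
end
end
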